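/- arXiv:1608.06372 — 5 statements merged into one kernel-verified Lean document; each statement's English description precedes it below -/
import Mathlib

section
/- Assume r ≥ 2 and set δ_r = μ_r − μ_{r−1} ≥ 1. For every n ≥ 1, one has I_n = ⟨I_{n−1}⟩_{K[X_n]} + (∏_{i=1}^{c} x_{i,n}^{a_{i,μ_r}}) · ⟨J_{n−δ_r}⟩_{K[X_n]}, where ⟨·⟩_{K[X_n]} denotes the ideal of K[X_n] generated by the indicated set and J_m is defined to be the zero ideal for m < 0. -/
open MvPolynomial

noncomputable section

/-- The monomial `x^a = ∏_{i} ∏_{1 ≤ j ≤ μ_r} x_{i,j}^{a_{i,j}}` in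
`K[X] = K[x_{i,j} : 1 ≤ i ≤ c, j ≥ 1]` (column indices in `ℕ`, only indices `≥ 1` occur). -/
def orbMonC (K : Type*) [Field K] (c r : ℕ) (μ : ℕ → ℕ) (a : Fin c → ℕ → ℕ) :
    MvPolynomial (Fin c × ℕ) K :=
  ∏ i : Fin c, ∏ j ∈ Finset.Icc 1 (μ (r - 1)),
    (X (i, j) : MvPolynomial (Fin c × ℕ) K) ^ a i j

/-- The ideal generated by the `Inc`-orbit of a polynomial, the monoid `Inc` of strictly
increasing maps acting by `π · x_{i,j} = x_{i,π(j)}`. -/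
def orbitIdealC (K : Type*) [Field K] {c : ℕ} (m : MvPolynomial (Fin c × ℕ) K) :
    Ideal (MvPolynomial (Fin c × ℕ) K) :=
  Ideal.span {q | ∃ π : ℕ → ℕ, StrictMono π ∧ q = rename (fun p => (p.1, π p.2)) m}

/-- Index type for the columns `1, …, n` of `K[X_n]`. -/
abbrev ColIdx (n : ℕ) := {j : ℕ // j ∈ Finset.Icc 1 n}

/-- The inclusion `K[X_n] → K[X]`. -/
def toBigC (K : Type*) [Field K] (c n : ℕ) :
    MvPolynomial (Fin c × ColIdx n) K →ₐ[K] MvPolynomial (Fin c × ℕ) K :=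
  rename fun p => (p.1, p.2.1)

/-- `I_n = I ∩ K[X_n]`, realized as an ideal of `K[X_n]` (this is legitimate because
`toBigC` is injective). -/
def restrC (K : Type*) [Field K] {c : ℕ} (I : Ideal (MvPolynomial (Fin c × ℕ) K)) (n : ℕ) :
    Ideal (MvPolynomial (Fin c × ColIdx n) K) :=
  Ideal.comap (toBigC K c n) I

/-- The inclusion `K[X_m] → K[X_n]` for `m ≤ n`. -/
def inclC (K : Type*) [Field K] (c : ℕ) {m n : ℕ} (h : m ≤ n) :
    MvPolynomial (Fin c × ColIdx m) K →ₐ[K] MvPolynomial (Fin c × ColIdx n) K :=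
  rename fun p => (p.1, ⟨p.2.1, Finset.Icc_subset_Icc le_rfl h p.2.2⟩)

/-- The dimension of the degree `j` component of `K[X_n]/I`, for a homogeneous ideal `I`:
the `K`-dimension of (homogeneous polynomials of degree `j`) modulo (those lying in `I`). -/
def hilbF (K : Type*) [Field K] {σ : Type*} (I : Ideal (MvPolynomial σ K)) (j : ℕ) : ℕ :=
  Module.finrank K
    (↥(homogeneousSubmodule σ K j) ⧸
      (Submodule.comap (homogeneousSubmodule σ K j).subtype (Submodule.restrictScalars K I)))

/-- The Hilbert series of `K[X_n]/I` as a power series in `ℤ[[t]]`. -/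
def hseries (K : Type*) [Field K] {σ : Type*} (I : Ideal (MvPolynomial σ K)) :
    PowerSeries ℤ :=
  PowerSeries.mk fun j => (hilbF K I j : ℤ)

end

/-- The ideal generated by a set of monomials contracts along an injective renaming of variables to
the ideal generated by the monomials it contains. -/
theorem comap_rename_span_monomial {R σ τ : Type*} [CommSemiring R] {f : σ → τ}
    (hf : Function.Injective f) {G : Set (MvPolynomial τ R)}
    (hG : ∀ g ∈ G, ∃ s, g = monomial s 1) :
    Ideal.comap (rename f : MvPolynomial σ R →ₐ[R] MvPolynomial τ R) (Ideal.span G) =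
      Ideal.span {q | rename f q ∈ G} := by
  apply le_antisymm
  · intro p hp
    have hG' : G = (fun s => monomial s (1 : R)) '' {s | monomial s (1 : R) ∈ G} := by
      ext g
      constructor
      · intro hg
        obtain ⟨s, rfl⟩ := hG g hg
        exact ⟨s, hg, rfl⟩
      · rintro ⟨s, hs, rfl⟩
        exact hs
    rw [Ideal.mem_comap, hG', mem_ideal_span_monomial_image] at hp
    rw [← support_sum_monomial_coeff p]
    refine Ideal.sum_mem _ fun t ht => ?_
    obtain ⟨s, hs, hst⟩ := hp (t.mapDomain f) (by
      rw [mem_support_iff, coeff_rename_mapDomain f hf]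
      exact mem_support_iff.mp ht)
    have hsupp : ↑s.support ⊆ Set.range f := by
      intro y hy
      by_contra hy'
      have := hst y
      rw [Finsupp.mapDomain_of_notMem_range _ _ hy'] at this
      exact (Finsupp.mem_support_iff.mp hy) (Nat.le_zero.mp this)
    set u := s.comapDomain f hf.injOn with hu
    have hus : u.mapDomain f = s := Finsupp.mapDomain_comapDomain f hf s hsupp
    have hut : u ≤ t := fun x => by
      have := hst (f x)
      rwa [Finsupp.mapDomain_apply hf] at this
    have : monomial t (coeff t p) = monomial (t - u) (coeff t p) * monomial u 1 := by
      rw [monomial_mul, mul_one, tsub_add_cancel_of_le hut]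
    rw [this]
    refine Ideal.mul_mem_left _ _ (Ideal.subset_span ?_)
    rw [Set.mem_ofPred_eq, rename_monomial, hus]
    exact hs
  · exact Ideal.span_le.mpr fun q hq => Ideal.subset_span hq

/-- The image of the monomial `∏_{i} ∏_{1 ≤ j ≤ M} x_{i,j}^{a_{i,j}}` under `π`. -/
noncomputable def shiftedMon (K : Type*) [Field K] {c : ℕ} (a : Fin c → ℕ → ℕ) (M : ℕ)
    (π : ℕ → ℕ) : MvPolynomial (Fin c × ℕ) K :=
  ∏ i : Fin c, ∏ j ∈ Finset.Icc 1 M, (X (i, π j) : MvPolynomial (Fin c × ℕ) K) ^ a i j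

section

variable {K : Type*} [Field K] {c : ℕ} {a : Fin c → ℕ → ℕ}

theorem rename_orbMonC (r : ℕ) (μ : ℕ → ℕ) (π : ℕ → ℕ) :
    rename (fun p : Fin c × ℕ => (p.1, π p.2)) (orbMonC K c r μ a) =
      shiftedMon K a (μ (r - 1)) π := by
  simp [orbMonC, shiftedMon, map_prod]

theorem exists_shiftedMon_eq_monomial (M : ℕ) (π : ℕ → ℕ) :
    ∃ s, shiftedMon K a M π = monomial s 1 := by
  have : shiftedMon K a M π ∈ MonoidHom.mrange (monomialOneHom K (Fin c × ℕ)) :=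
    prod_mem fun i _ => prod_mem fun j _ =>
      pow_mem (MonoidHom.mem_mrange.mpr ⟨Multiplicative.ofAdd (Finsupp.single (i, π j) 1), rfl⟩) _
  obtain ⟨s, hs⟩ := this
  exact ⟨Multiplicative.toAdd s, hs.symm⟩

theorem toBigC_index_injective (c n : ℕ) :
    Function.Injective fun p : Fin c × ColIdx n => (p.1, p.2.1) := by
  rintro ⟨i, j⟩ ⟨i', j'⟩ h
  simp only [Prod.mk.injEq] at h
  exact Prod.ext h.1 (Subtype.ext h.2)

theorem toBigC_injective (n : ℕ) : Function.Injective (toBigC K c n) :=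
  rename_injective _ (toBigC_index_injective c n)

theorem toBigC_inclC {m n : ℕ} (h : m ≤ n) (q : MvPolynomial (Fin c × ColIdx m) K) :
    toBigC K c n (inclC K c h q) = toBigC K c m q := by
  simp only [toBigC, inclC, rename_rename]
  rfl

theorem toBigC_prod_X {n : ℕ} (j : ColIdx n) (b : Fin c → ℕ) :
    toBigC K c n (∏ i, X (i, j) ^ b i) = ∏ i, X (i, j.1) ^ b i := by
  simp [toBigC, map_prod]

theorem orbitIdealC_orbMonC (r : ℕ) (μ : ℕ → ℕ) :
    orbitIdealC K (orbMonC K c r μ a) =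
      Ideal.span {q | ∃ π, StrictMono π ∧ q = shiftedMon K a (μ (r - 1)) π} := by
  simp only [orbitIdealC, rename_orbMonC]

theorem restrC_orbitIdealC_orbMonC (r : ℕ) (μ : ℕ → ℕ) (n : ℕ) :
    restrC K (orbitIdealC K (orbMonC K c r μ a)) n =
      Ideal.span {q | ∃ π, StrictMono π ∧ toBigC K c n q = shiftedMon K a (μ (r - 1)) π} := by
  rw [orbitIdealC_orbMonC]
  refine comap_rename_span_monomial (toBigC_index_injective c n) ?_
  rintro _ ⟨π, -, rfl⟩
  exact exists_shiftedMon_eq_monomial _ π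

theorem exists_toBigC_eq_shiftedMon {M n : ℕ} {π : ℕ → ℕ} (hπ : StrictMono π) (h : π M ≤ n) :
    ∃ q, toBigC K c n q = shiftedMon K a M π := by
  have : shiftedMon K a M π ∈ (toBigC K c n).range := by
    refine prod_mem fun i _ => prod_mem fun j hj => pow_mem ?_ _
    rw [Finset.mem_Icc] at hj
    exact ⟨X (i, ⟨π j, Finset.mem_Icc.mpr
      ⟨hj.1.trans (hπ.id_le j), (hπ.monotone hj.2).trans h⟩⟩), by simp [toBigC]⟩
  exact this

/-- If the column `M` is nonzero, then a shifted monomial in `K[X_n]` has its last column at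
most `n`. -/
theorem le_of_toBigC_eq_shiftedMon {M n : ℕ} {π : ℕ → ℕ} (hM : 1 ≤ M) {i : Fin c}
    (hi : a i M ≠ 0) {q : MvPolynomial (Fin c × ColIdx n) K}
    (h : toBigC K c n q = shiftedMon K a M π) : π M ≤ n := by
  by_contra! hlt
  have key : ∀ v : Fin c × ℕ → K, (∀ p : Fin c × ColIdx n, v (p.1, p.2.1) = 1) →
      eval v (shiftedMon K a M π) = eval (fun _ => 1) q := by
    intro v hv
    rw [← h, toBigC, eval_rename]
    congr 2
    funext p
    exact hv p
  have h1 := key (fun _ => 1) fun _ => rfl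
  have h0 := key (fun p => if p.2 ≤ n then 1 else 0) fun p => if_pos (Finset.mem_Icc.mp p.2.2).2
  rw [← h1] at h0
  simp only [shiftedMon, map_prod, map_pow, eval_X, one_pow, Finset.prod_const_one] at h0
  refine zero_ne_one ((Finset.prod_eq_zero (Finset.mem_univ i) ?_).symm.trans h0)
  refine Finset.prod_eq_zero (Finset.mem_Icc.mpr ⟨hM, le_rfl⟩) ?_
  rw [if_neg hlt.not_ge, zero_pow hi]

theorem shiftedMon_eq_mul {L M : ℕ} (hLM : L < M)
    (ha : ∀ i j, L < j → j < M → a i j = 0) (π : ℕ → ℕ) :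
    shiftedMon K a M π = (∏ i, X (i, π M) ^ a i M) * shiftedMon K a L π := by
  simp only [shiftedMon]
  rw [← Finset.prod_mul_distrib]
  refine Finset.prod_congr rfl fun i _ => ?_
  rw [← Finset.prod_insert (f := fun j => (X (i, π j) : MvPolynomial (Fin c × ℕ) K) ^ a i j)
    (by simp [hLM])]
  symm
  refine Finset.prod_subset ?_ ?_
  · intro j hj
    simp only [Finset.mem_insert, Finset.mem_Icc] at hj ⊢
    omega
  · intro j hj hj'
    simp only [Finset.mem_insert, Finset.mem_Icc] at hj hj'
    rw [ha i j (by omega) (by omega), pow_zero]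

theorem shiftedMon_congr {M : ℕ} {π ρ : ℕ → ℕ} (h : ∀ j ≤ M, π j = ρ j) :
    shiftedMon K a M π = shiftedMon K a M ρ :=
  Finset.prod_congr rfl fun i _ => Finset.prod_congr rfl fun j hj => by
    rw [h j (Finset.mem_Icc.mp hj).2]

end

/-- A strictly increasing function can be modified beyond `L` so as to take the value `n` at `M`. -/
theorem exists_strictMono_extension {L M n : ℕ} (hLM : L < M) {π : ℕ → ℕ} (hπ : StrictMono π)
    (h : π L + (M - L) ≤ n) : ∃ ρ : ℕ → ℕ, StrictMono ρ ∧ (∀ j ≤ L, ρ j = π j) ∧ ρ M = n := by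
  refine ⟨fun j => if j ≤ L then π j else n + j - M, strictMono_nat_of_lt_succ fun j => ?_,
    fun j hj => if_pos hj, ?_⟩
  · have h1 := hπ (Nat.lt_succ_self j)
    split_ifs with h2 h3
    · exact h1
    · obtain rfl : j = L := by omega
      omega
    · omega
    · omega
  · dsimp only
    rw [if_neg hLM.not_ge, Nat.add_sub_cancel]

theorem add_sub_le_of_strictMono {π : ℕ → ℕ} (hπ : StrictMono π) {L M : ℕ} (hLM : L ≤ M) :
    π L + (M - L) ≤ π M := by
  simpa [Nat.sub_add_cancel hLM, add_comm] using hπ.add_le_nat (M - L) L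

/-- For `r ≥ 2`, `δ_r = μ_r - μ_{r-1}` and `n ≥ 1`:
`I_n = ⟨I_{n-1}⟩_{K[X_n]} + (∏ᵢ x_{i,n}^{a_{i,μ_r}})·⟨J_{n-δ_r}⟩_{K[X_n]}`,
with `J_m := 0` for `m < 0`. -/
theorem statement11 (K : Type*) [Field K] (c : ℕ) (hc : 1 ≤ c) (r : ℕ) (hr : 2 ≤ r)
    (μ : ℕ → ℕ) (hμ1 : 1 ≤ μ 0) (hμ : ∀ j, j + 1 < r → μ j < μ (j + 1))
    (a : Fin c → ℕ → ℕ) (hcols : ∀ j : ℕ, (∃ i, a i j ≠ 0) ↔ ∃ k, k < r ∧ j = μ k)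
    (n : ℕ) (hn : 1 ≤ n) :
    restrC K (orbitIdealC K (orbMonC K c r μ a)) n =
      Ideal.map (inclC K c (Nat.sub_le n 1))
        (restrC K (orbitIdealC K (orbMonC K c r μ a)) (n - 1)) +
      (if n < μ (r - 1) - μ (r - 2) then (⊥ : Ideal (MvPolynomial (Fin c × ColIdx n) K))
       else
        Ideal.span {∏ i : Fin c,
            (X (i, (⟨n, Finset.mem_Icc.mpr ⟨hn, le_rfl⟩⟩ : ColIdx n)) :
              MvPolynomial (Fin c × ColIdx n) K) ^ a i (μ (r - 1))} *
          Ideal.map (inclC K c (Nat.sub_le n (μ (r - 1) - μ (r - 2))))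
            (restrC K (orbitIdealC K (orbMonC K c (r - 1) μ a))
              (n - (μ (r - 1) - μ (r - 2))))) := by
  have hLM : μ (r - 2) < μ (r - 1) := by
    have := hμ (r - 2) (by omega)
    rwa [show r - 2 + 1 = r - 1 by omega] at this
  have hmono : ∀ k < r, ∀ l ≤ k, μ l ≤ μ k := by
    intro k
    induction k with
    | zero => intro _ l hl; rw [Nat.le_zero.mp hl]
    | succ k ih =>
      intro hk l hl
      rcases Nat.lt_or_eq_of_le hl with h | rfl
      · exact (ih (by omega) l (by omega)).trans (hμ k hk).le
      · exact le_rfl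
  have hL : 1 ≤ μ (r - 2) := hμ1.trans (hmono _ (by omega) 0 (by omega))
  obtain ⟨i₁, hi₁⟩ := (hcols (μ (r - 1))).mpr ⟨r - 1, by omega, rfl⟩
  obtain ⟨i₂, hi₂⟩ := (hcols (μ (r - 2))).mpr ⟨r - 2, by omega, rfl⟩
  have hgap : ∀ i j, μ (r - 2) < j → j < μ (r - 1) → a i j = 0 := by
    intro i j h1 h2
    by_contra h
    obtain ⟨k, hk, rfl⟩ := (hcols j).mp ⟨i, h⟩
    rcases Nat.lt_or_ge k (r - 1) with hk' | hk'
    · exact h1.not_ge (hmono (r - 2) (by omega) k (by omega))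
    · exact h2.not_ge (hmono k hk (r - 1) hk')
  have hJ := restrC_orbitIdealC_orbMonC (K := K) (a := a) (r - 1) μ
    (n - (μ (r - 1) - μ (r - 2)))
  rw [show r - 1 - 1 = r - 2 by omega] at hJ
  rw [hJ]
  generalize μ (r - 2) = L at *
  have hI := restrC_orbitIdealC_orbMonC (K := K) (a := a) r μ
  generalize μ (r - 1) = M at *
  apply le_antisymm
  · rw [hI n, Ideal.span_le]
    rintro q ⟨π, hπ, hq⟩
    have hle := le_of_toBigC_eq_shiftedMon (hL.trans hLM.le) hi₁ hq
    rcases Nat.lt_or_eq_of_le hle with hlt | heq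
    · refine Ideal.mem_sup_left ?_
      obtain ⟨q', hq'⟩ := exists_toBigC_eq_shiftedMon (K := K) (a := a) hπ (Nat.le_pred_of_lt hlt)
      have : q = inclC K c (Nat.sub_le n 1) q' :=
        toBigC_injective n (by rw [toBigC_inclC, hq, ← hq']; rfl)
      rw [this]
      refine Ideal.mem_map_of_mem _ ?_
      rw [hI]
      exact Ideal.subset_span ⟨π, hπ, hq'⟩
    · refine Ideal.mem_sup_right ?_
      have hshift := add_sub_le_of_strictMono hπ hLM.le
      rw [if_neg (by omega)]
      obtain ⟨q', hq'⟩ := exists_toBigC_eq_shiftedMon (K := K) (a := a) hπ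
        (show π L ≤ n - (M - L) by omega)
      have : q = (∏ i : Fin c, X (i, (⟨n, Finset.mem_Icc.mpr ⟨hn, le_rfl⟩⟩ : ColIdx n)) ^ a i M) *
          inclC K c (Nat.sub_le n (M - L)) q' :=
        toBigC_injective n (by
          rw [map_mul, toBigC_inclC, hq, hq', toBigC_prod_X, shiftedMon_eq_mul hLM hgap, heq])
      rw [this]
      exact Ideal.mul_mem_mul (Ideal.mem_span_singleton_self _)
        (Ideal.mem_map_of_mem _ (Ideal.subset_span ⟨π, hπ, hq'⟩))
  · refine sup_le (Ideal.map_le_iff_le_comap.mpr fun q hq => ?_) ?_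
    · rw [restrC, Ideal.mem_comap] at hq
      rwa [restrC, Ideal.mem_comap, Ideal.mem_comap, toBigC_inclC]
    · split_ifs with hδ
      · exact bot_le
      · rw [Ideal.map_span, Ideal.span_mul_span', Ideal.span_le, hI]
        rintro _ ⟨_, rfl, _, ⟨q, ⟨π, hπ, hq⟩, rfl⟩, rfl⟩
        have hle := le_of_toBigC_eq_shiftedMon hL hi₂ hq
        obtain ⟨ρ, hρ, hρπ, hρM⟩ := exists_strictMono_extension (n := n) hLM hπ (by omega)
        refine Ideal.subset_span ⟨ρ, hρ, ?_⟩
        rw [shiftedMon_eq_mul hLM hgap, hρM, shiftedMon_congr hρπ, ← hq]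
        dsimp only
        rw [map_mul, toBigC_prod_X, toBigC_inclC]
end

section
/- If n ≥ μ_r, then A_n = K[X_n]/I_n is a Cohen–Macaulay ring of Krull dimension n(c−1) + μ_r − 1. -/
open MvPolynomial

open RingTheory.Sequence in
/-- The depth (grade) of an ideal `P` on `R`: the supremum of the lengths of regular
sequences on `R` consisting of elements of `P`. -/
noncomputable def depthAt (R : Type*) [CommRing R] (P : Ideal R) : ℕ∞ :=
  sSup {d : ℕ∞ | ∃ rs : List R, (rs.length : ℕ∞) = d ∧ (∀ x ∈ rs, x ∈ P) ∧ IsRegular R rs}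

/-- A commutative ring is Cohen–Macaulay if for every maximal ideal `P` the depth of `P`
on `R` equals the Krull dimension of the localization of `R` at `P`. -/
def IsCohenMacaulayRing (R : Type*) [CommRing R] : Prop :=
  ∀ P : Ideal R, (hP : P.IsMaximal) →
    (depthAt R P : WithBot ℕ∞) = ringKrullDim (@Localization.AtPrime R _ P hP.isPrime)

open CategoryTheory Abelian

universe u

/-- `Ext^i(S ⧸ P, M) = 0` for all `i < d`. -/
def ExtVanishesBelow {S : Type u} [CommRing S] (P : Ideal S) (d : ℕ) (M : Type u) [AddCommGroup M]
    [Module S M] : Prop :=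
  ∀ i < d, Subsingleton (Ext (ModuleCat.of S (S ⧸ P)) (ModuleCat.of S M) i)

namespace ExtVanishesBelow

variable {S : Type u} [CommRing S] {P : Ideal S} {d : ℕ} {A B C : Type u}
  [AddCommGroup A] [Module S A] [AddCommGroup B] [Module S B] [AddCommGroup C] [Module S C]

theorem of_subsingleton [Subsingleton A] : ExtVanishesBelow P d A := fun _ _ ↦
  have h : Limits.IsZero (ModuleCat.of S A) := ModuleCat.isZero_of_subsingleton _
  ⟨fun x y ↦ by
    rw [← Ext.comp_mk₀_id x, ← Ext.comp_mk₀_id y, h.eq_of_src (𝟙 (ModuleCat.of S A)) 0]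
    simp⟩

theorem left {f : A →ₗ[S] B} {g : B →ₗ[S] C} (hf : Function.Injective f)
    (hg : Function.Surjective g) (hfg : Function.Exact f g)
    (hB : ExtVanishesBelow P (d + 1) B) (hC : ExtVanishesBelow P d C) :
    ExtVanishesBelow P (d + 1) A := by
  have hS := ModuleCat.shortComplex_shortExact
    (ModuleCat.shortComplexOfCompEqZero f g hfg.linearMap_comp_eq_zero) hfg hf hg
  intro i hi
  have := hB i hi
  refine subsingleton_of_forall_eq 0 fun x ↦ ?_
  match i with
  | 0 =>
    have := hS.mono_f
    apply Ext.postcomp_mk₀_injective_of_mono _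
      (ModuleCat.shortComplexOfCompEqZero f g hfg.linearMap_comp_eq_zero).f
    exact Subsingleton.elim (α := Ext _ (ModuleCat.of S B) 0) _ _
  | i + 1 =>
    have := hC i (by omega)
    obtain ⟨y, hy⟩ := Ext.covariant_sequence_exact₁ (ModuleCat.of S (S ⧸ P)) hS x
      (Subsingleton.elim (α := Ext _ (ModuleCat.of S B) (i + 1)) _ _) rfl
    rw [← hy, show y = 0 from Subsingleton.elim (α := Ext _ (ModuleCat.of S C) i) _ _]
    simp

theorem right {f : A →ₗ[S] B} {g : B →ₗ[S] C} (hf : Function.Injective f)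
    (hg : Function.Surjective g) (hfg : Function.Exact f g)
    (hA : ExtVanishesBelow P (d + 1) A) (hB : ExtVanishesBelow P d B) :
    ExtVanishesBelow P d C := by
  have hS := ModuleCat.shortComplex_shortExact
    (ModuleCat.shortComplexOfCompEqZero f g hfg.linearMap_comp_eq_zero) hfg hf hg
  intro i hi
  have := hA (i + 1) (by omega)
  have := hB i hi
  refine subsingleton_of_forall_eq 0 fun x ↦ ?_
  obtain ⟨y, hy⟩ := Ext.covariant_sequence_exact₃ (ModuleCat.of S (S ⧸ P)) hS x rfl
    (Subsingleton.elim (α := Ext _ (ModuleCat.of S A) (i + 1)) _ _)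
  rw [← hy, show y = 0 from Subsingleton.elim (α := Ext _ (ModuleCat.of S B) i) _ _]
  simp

theorem quotient_sup_span_singleton_mul {J L : Ideal S} {y : S} (hJL : J ≤ L)
    (hy : ∀ f, y * f ∈ J → f ∈ J) (hJ : ExtVanishesBelow P (d + 1) (S ⧸ J))
    (hL : ExtVanishesBelow P d (S ⧸ L)) :
    ExtVanishesBelow P d (S ⧸ J ⊔ Ideal.span {y} * L) := by
  let g : (S ⧸ J) →ₗ[S] (S ⧸ L) := Submodule.factor hJL
  let h : (S ⧸ J) →ₗ[S] (S ⧸ J ⊔ Ideal.span {y} * L) := Submodule.factor le_sup_left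
  have hA : ExtVanishesBelow P (d + 1) (LinearMap.ker g) :=
    left (f := (LinearMap.ker g).subtype) (g := g) (Submodule.subtype_injective _)
      (Submodule.factor_surjective hJL) (LinearMap.exact_subtype_ker_map g) hJ hL
  have hinj : Function.Injective (LinearMap.lsmul S (S ⧸ J) y) := by
    rw [injective_iff_map_eq_zero]
    intro a ha
    obtain ⟨a, rfl⟩ := Ideal.Quotient.mk_surjective a
    rw [Ideal.Quotient.eq_zero_iff_mem]
    exact hy a (Ideal.Quotient.eq_zero_iff_mem.mp ha)
  refine right (f := LinearMap.lsmul S (S ⧸ J) y ∘ₗ (LinearMap.ker g).subtype) (g := h)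
    (hinj.comp (Submodule.subtype_injective _)) (Submodule.factor_surjective _) ?_ hA
    (fun i hi ↦ hJ i (by omega))
  intro b
  obtain ⟨b, rfl⟩ := Ideal.Quotient.mk_surjective b
  have hb : h (Ideal.Quotient.mk J b) = 0 ↔ b ∈ J ⊔ Ideal.span {y} * L :=
    Ideal.Quotient.eq_zero_iff_mem
  have hg (a : S) : g (Ideal.Quotient.mk J a) = 0 ↔ a ∈ L := Ideal.Quotient.eq_zero_iff_mem
  rw [hb, Submodule.mem_sup]
  constructor
  · rintro ⟨j, hj, z, hz, rfl⟩
    obtain ⟨l, hl, rfl⟩ := Ideal.mem_span_singleton_mul.mp hz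
    refine ⟨⟨Ideal.Quotient.mk J l, (hg l).mpr hl⟩, ?_⟩
    refine Ideal.Quotient.eq.mpr ?_
    simpa using J.neg_mem hj
  · rintro ⟨⟨a, ha⟩, hab⟩
    obtain ⟨a, rfl⟩ := Ideal.Quotient.mk_surjective a
    have : y * a - b ∈ J := Ideal.Quotient.eq.mp hab
    exact ⟨_, J.neg_mem this, y * a,
      Ideal.mem_span_singleton_mul.mpr ⟨a, (hg a).mp ha, rfl⟩, by ring⟩

end ExtVanishesBelow

namespace MvPolynomial

variable {σ K : Type*} [Field K]

attribute [local instance] MvPolynomial.algebraMvPolynomial in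
theorem eq_zero_of_map_algebraMap_mul_eq_zero (Q : Type*) [CommRing Q] [Algebra K Q]
    {g : MvPolynomial σ K} (hg : g ≠ 0) {f : MvPolynomial σ Q}
    (h : map (algebraMap K Q) g * f = 0) : f = 0 := by
  have : Module.Flat (MvPolynomial σ K) (MvPolynomial σ Q) :=
    Module.Flat.isBaseChange K (MvPolynomial σ K) Q (MvPolynomial σ Q)
      (Algebra.IsPushout.out (R := K) (S := MvPolynomial σ K) (R' := Q))
  have := Module.Flat.isSMulRegular_of_nonZeroDivisors (M := MvPolynomial σ Q)
    (mem_nonZeroDivisors_of_ne_zero hg)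
  apply this
  simpa [Algebra.smul_def] using h

/-- A nonzero polynomial is a nonzerodivisor modulo an ideal generated by polynomials in other
variables. -/
theorem mem_span_of_mul_mem_span_of_supported {T : Set σ} {A : Set (MvPolynomial σ K)}
    (hA : A ⊆ supported K T) {g : MvPolynomial σ K} (hg : g ∈ supported K Tᶜ) (hg0 : g ≠ 0)
    {f : MvPolynomial σ K} (h : g * f ∈ Ideal.span A) : f ∈ Ideal.span A := by
  classical
  let J := Ideal.span A
  let ι : MvPolynomial T K →ₐ[K] MvPolynomial σ K := rename Subtype.val
  let J' : Ideal (MvPolynomial T K) := J.comap ι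
  let Q := MvPolynomial T K ⧸ J'
  let φ : MvPolynomial σ K →ₐ[K] MvPolynomial (Tᶜ : Set σ) Q := aeval fun v ↦
    if hv : v ∈ T then C (Ideal.Quotient.mk J' (X ⟨v, hv⟩)) else X ⟨v, hv⟩
  let ψ₀ : Q →+* MvPolynomial σ K ⧸ J := Ideal.quotientMap J ι.toRingHom le_rfl
  let ψ : MvPolynomial (Tᶜ : Set σ) Q →+* MvPolynomial σ K ⧸ J :=
    eval₂Hom ψ₀ fun v ↦ Ideal.Quotient.mk J (X v)
  have hψ₀ (p) : ψ₀ (Ideal.Quotient.mk J' p) = Ideal.Quotient.mk J (ι p) := rfl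
  have hψφ (p) : ψ (φ p) = Ideal.Quotient.mk J p := by
    suffices ψ.comp φ.toRingHom = Ideal.Quotient.mk J from congrArg (· p) this
    apply ringHom_ext
    · intro a
      have : φ (C a) = C (Ideal.Quotient.mk J' (C a)) := by
        rw [← algebraMap_eq, AlgHom.commutes]; rfl
      simp [ψ, this, hψ₀, ι]
    · intro v
      by_cases hv : v ∈ T
      · simp [φ, hv, ψ, hψ₀, ι]
      · simp [φ, hv, ψ]
  have hφι (p) : φ (ι p) = C (Ideal.Quotient.mk J' p) := by
    suffices φ.comp ι = (IsScalarTower.toAlgHom K Q (MvPolynomial (Tᶜ : Set σ) Q)).comp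
      (Ideal.Quotient.mkₐ K J') from congrArg (· p) this
    refine algHom_ext fun v ↦ ?_
    simp [φ, ι, algebraMap_eq]
    rfl
  have hJ : J ≤ RingHom.ker φ := by
    refine Ideal.span_le.mpr fun a ha ↦ ?_
    have h₁ := hA ha
    rw [supported_eq_range_rename] at h₁
    obtain ⟨a', rfl⟩ := h₁
    have : Ideal.Quotient.mk J' a' = 0 :=
      Ideal.Quotient.eq_zero_iff_mem.mpr (Ideal.subset_span ha)
    exact (hφι a').trans (by rw [this, map_zero])
  rw [supported_eq_range_rename] at hg
  obtain ⟨g, rfl⟩ := hg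
  have hφg : φ (rename Subtype.val g) = map (algebraMap K Q) g := by
    suffices φ.comp (rename Subtype.val) = mapAlgHom (Algebra.ofId K Q) from
      congrArg (· g) this
    refine algHom_ext fun v ↦ ?_
    simp [φ, dif_neg v.2]
  have h₀ : φ f = 0 := by
    refine eq_zero_of_map_algebraMap_mul_eq_zero Q (g := g) (fun h ↦ hg0 (by simp [h])) ?_
    rw [← hφg, ← map_mul]
    exact hJ h
  rw [← Ideal.Quotient.eq_zero_iff_mem]
  exact (hψφ f).symm.trans (by rw [h₀, map_zero])

variable [Finite σ]

theorem exists_isRegular_of_isMaximal (P : Ideal (MvPolynomial σ K)) [hP : P.IsMaximal] :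
    ∃ rs : List (MvPolynomial σ K), rs.length = Nat.card σ ∧ (∀ x ∈ rs, x ∈ P) ∧
      RingTheory.Sequence.IsRegular (MvPolynomial σ K) rs := by
  classical
  have := Fintype.ofFinite σ
  have hex (v : σ) : ∃ g ∈ supported K {v}, g ≠ 0 ∧ g ∈ P := by
    let := Ideal.Quotient.field P
    have := finite_of_finite_type_of_isJacobsonRing K (MvPolynomial σ K ⧸ P)
    obtain ⟨q, hq0, hq⟩ := Algebra.IsAlgebraic.isAlgebraic (R := K) (Ideal.Quotient.mk P (X v))
    refine ⟨Polynomial.aeval (X v) q, ?_, ?_, ?_⟩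
    · simp [supported_eq_adjoin_X, Polynomial.aeval_mem_adjoin_singleton]
    · exact fun h ↦ (algebraicIndependent_X σ K).transcendental v ⟨q, hq0, h⟩
    · rw [← Ideal.Quotient.eq_zero_iff_mem, ← hq]
      exact (Polynomial.aeval_algHom_apply (Ideal.Quotient.mkₐ K P) _ _).symm
  choose g hgs hg0 hgP using hex
  have hw (l : List σ) (hl : l.Nodup) :
      RingTheory.Sequence.IsWeaklyRegular (MvPolynomial σ K) (l.map g) := by
    induction l using List.reverseRecOn with
    | nil => simp
    | append_singleton l v ih =>
      rw [List.nodup_append] at hl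
      rw [List.map_append, RingTheory.Sequence.isWeaklyRegular_append_iff]
      refine ⟨ih hl.1, ?_⟩
      simp only [List.map_cons, List.map_nil, RingTheory.Sequence.isWeaklyRegular_singleton_iff]
      rw [isSMulRegular_quotient_iff_mem_of_smul_mem]
      intro f hf
      simp only [smul_eq_mul, Ideal.mul_top] at hf ⊢
      refine mem_span_of_mul_mem_span_of_supported (T := {w | w ∈ l}) ?_
        (supported_mono ?_ (hgs v)) (hg0 v) hf
      · intro x hx
        obtain ⟨w, hw, rfl⟩ := List.mem_map.mp hx
        exact supported_mono (by simpa using hw) (hgs w)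
      · simpa using fun h ↦ hl.2.2 v h v (by simp) rfl
  have hmem : ∀ x ∈ Finset.univ.toList.map g, x ∈ P := by simp [hgP]
  refine ⟨Finset.univ.toList.map g, by simp, hmem, hw _ (Finset.nodup_toList _), fun h ↦ ?_⟩
  rw [smul_eq_mul, Ideal.mul_top] at h
  exact hP.ne_top (top_le_iff.mp (h.le.trans (Ideal.span_le.mpr hmem)))

end MvPolynomial

/-- The products `∏ i < k, y i (q i)` with `q` weakly increasing and bounded by `t`. -/
def chainProducts {R : Type*} [CommRing R] (y : ℕ → ℕ → R) (k t : ℕ) : Set R :=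
  {f | ∃ q : ℕ → ℕ, MonotoneOn q (Set.Iio k) ∧ (∀ i < k, q i < t) ∧
    f = ∏ i ∈ Finset.range k, y i (q i)}

/-- The ideal generated by the products `∏ i < k, y i (q i)` with `q` weakly increasing and
bounded by `t`. -/
def chainIdeal {R : Type*} [CommRing R] (y : ℕ → ℕ → R) (k t : ℕ) : Ideal R :=
  Ideal.span (chainProducts y k t)

section chainIdeal

variable {R : Type*} [CommRing R] (y : ℕ → ℕ → R)

theorem chainIdeal_zero (t : ℕ) : chainIdeal y 0 t = ⊤ :=
  (Ideal.eq_top_iff_one _).mpr <| Ideal.subset_span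
    ⟨id, monotone_id.monotoneOn _, by simp, by simp⟩

theorem chainIdeal_succ_zero (k : ℕ) : chainIdeal y (k + 1) 0 = ⊥ := by
  refine Ideal.span_eq_bot.mpr ?_
  rintro _ ⟨q, -, hq, -⟩
  exact absurd (hq 0 (by omega)) (by omega)

theorem chainIdeal_succ_le (k t : ℕ) : chainIdeal y (k + 1) t ≤ chainIdeal y k (t + 1) := by
  refine Ideal.span_le.mpr ?_
  rintro _ ⟨q, hm, hq, rfl⟩
  rw [Finset.prod_range_succ]
  refine Ideal.mul_mem_right _ _ (Ideal.subset_span ⟨q, ?_, fun i hi ↦ ?_, rfl⟩)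
  · exact hm.mono (Set.Iio_subset_Iio (by omega))
  · exact (hq i (by omega)).trans (by omega)

theorem chainIdeal_succ_succ (k t : ℕ) : chainIdeal y (k + 1) (t + 1) =
    chainIdeal y (k + 1) t ⊔ Ideal.span {y k t} * chainIdeal y k (t + 1) := by
  apply le_antisymm
  · refine Ideal.span_le.mpr ?_
    rintro _ ⟨q, hm, hq, rfl⟩
    have hle : ∀ i < k + 1, q i ≤ q k := fun i hi ↦
      hm (Set.mem_Iio.mpr hi) (Set.mem_Iio.mpr (by omega)) (by omega)
    obtain h | h := Nat.lt_succ_iff_lt_or_eq.mp (hq k (by omega))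
    · exact Ideal.mem_sup_left (Ideal.subset_span
        ⟨q, hm, fun i hi ↦ (hle i hi).trans_lt h, rfl⟩)
    · refine Ideal.mem_sup_right (Ideal.mem_span_singleton_mul.mpr
        ⟨_, Ideal.subset_span ⟨q, ?_, fun i hi ↦ hq i (by omega), rfl⟩, ?_⟩)
      · exact hm.mono (Set.Iio_subset_Iio (by omega))
      · rw [Finset.prod_range_succ, h, mul_comm]
  · refine sup_le (Ideal.span_mono ?_) ?_
    · rintro _ ⟨q, hm, hq, rfl⟩
      exact ⟨q, hm, fun i hi ↦ (hq i hi).trans (by omega), rfl⟩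
    · rw [chainIdeal, Ideal.span_mul_span', Ideal.span_le]
      rintro _ ⟨_, rfl, _, ⟨q, hm, hq, rfl⟩, rfl⟩
      refine Ideal.subset_span ⟨fun i ↦ if i < k then q i else t, ?_, ?_, ?_⟩
      · intro i hi j hj hij
        simp only [Set.mem_Iio] at hi hj
        dsimp only
        split_ifs with h₁ h₂ h₂
        · exact hm h₁ h₂ hij
        · exact Nat.lt_succ_iff.mp (hq i h₁)
        · omega
        · rfl
      · intro i hi
        dsimp only
        split_ifs with h
        · exact hq i h
        · omega
      · dsimp only
        rw [Finset.prod_range_succ, if_neg (lt_irrefl k), mul_comm]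
        congr 1
        exact Finset.prod_congr rfl fun i hi ↦ by rw [if_pos (Finset.mem_range.mp hi)]

end chainIdeal

theorem ExtVanishesBelow.quotient_chainIdeal {S : Type u} [CommRing S] {P : Ideal S} {d r N : ℕ}
    {y : ℕ → ℕ → S} (hS : ExtVanishesBelow P d (S ⧸ (⊥ : Ideal S)))
    (hy : ∀ k < r, ∀ t < N, ∀ f, y k t * f ∈ chainIdeal y (k + 1) t → f ∈ chainIdeal y (k + 1) t)
    {k : ℕ} (hk : k ≤ r) {t : ℕ} (ht : t ≤ N) {e : ℕ} (he : e + t = d) :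
    ExtVanishesBelow P e (S ⧸ chainIdeal y k t) := by
  induction k generalizing t e with
  | zero =>
    have : Subsingleton (S ⧸ chainIdeal y 0 t) :=
      Ideal.Quotient.subsingleton_iff.mpr (chainIdeal_zero y t)
    exact of_subsingleton
  | succ k ihk =>
    induction t generalizing e with
    | zero =>
      rw [chainIdeal_succ_zero]
      rw [add_zero] at he
      exact he ▸ hS
    | succ t iht =>
      rw [chainIdeal_succ_succ]
      exact quotient_sup_span_singleton_mul (chainIdeal_succ_le y k t) (hy k (by omega) t (by omega))
        (iht (by omega) (by omega)) (ihk (by omega) ht he)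

open RingTheory.Sequence in
/-- A Noetherian quotient `S ⧸ I` of dimension at most `d` is Cohen–Macaulay of dimension `d` if
every maximal ideal containing `I` contains an `S ⧸ I`-regular sequence of length `d`. -/
theorem isCohenMacaulayRing_quotient_of_exists_isRegular {S : Type*} [CommRing S]
    [IsNoetherianRing S] {I : Ideal S} (hI : I ≠ ⊤) {d : ℕ} (hd : ringKrullDim (S ⧸ I) ≤ d)
    (h : ∀ P : Ideal S, P.IsMaximal → I ≤ P →
      ∃ rs : List S, rs.length = d ∧ (∀ x ∈ rs, x ∈ P) ∧ IsRegular (S ⧸ I) rs) :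
    IsCohenMacaulayRing (S ⧸ I) ∧ ringKrullDim (S ⧸ I) = d := by
  have hex (P : Ideal (S ⧸ I)) (hP : P.IsMaximal) : ∃ rs : List (S ⧸ I), rs.length = d ∧
      (∀ x ∈ rs, x ∈ P) ∧ IsRegular (S ⧸ I) rs := by
    obtain ⟨rs, hl, hm, hr⟩ := h (P.comap (Ideal.Quotient.mk I))
      (Ideal.comap_isMaximal_of_surjective _ Ideal.Quotient.mk_surjective)
      (fun x hx ↦ by simp [Ideal.Quotient.eq_zero_iff_mem.mpr hx])
    have hm' : ∀ x ∈ rs.map (algebraMap S (S ⧸ I)), x ∈ P := by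
      simpa using hm
    refine ⟨rs.map (algebraMap S (S ⧸ I)), by simpa using hl, hm',
      (isWeaklyRegular_map_algebraMap_iff _ _ rs).mpr hr.1, fun h ↦ ?_⟩
    rw [smul_eq_mul, Ideal.mul_top] at h
    exact hP.ne_top (top_le_iff.mp (h.le.trans (Ideal.span_le.mpr hm')))
  have hlen (P : Ideal (S ⧸ I)) [P.IsPrime] (rs : List (S ⧸ I)) (hm : ∀ x ∈ rs, x ∈ P)
      (hr : IsRegular (S ⧸ I) rs) :
      ((rs.length : ℕ∞) : WithBot ℕ∞) ≤ ringKrullDim (Localization.AtPrime P) := by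
    have hr' := hr.1.isRegular_of_isLocalization_of_mem (Localization.AtPrime P) P hm
    rw [← ringKrullDim_add_length_eq_ringKrullDim_of_isRegular _ hr', List.length_map]
    have : Nontrivial (Localization.AtPrime P ⧸
        Ideal.ofList (rs.map (algebraMap (S ⧸ I) (Localization.AtPrime P)))) := by
      rw [Ideal.Quotient.nontrivial_iff]
      intro h
      apply hr'.2
      rw [h]
      simp
    exact le_add_of_nonneg_left ringKrullDim_nonneg_of_nontrivial
  have hloc (P : Ideal (S ⧸ I)) [P.IsPrime] :
      ringKrullDim (Localization.AtPrime P) ≤ ringKrullDim (S ⧸ I) := by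
    rw [IsLocalization.AtPrime.ringKrullDim_eq_height P]
    exact Ideal.height_le_ringKrullDim_of_ne_top Ideal.IsPrime.ne_top'
  have hge (P : Ideal (S ⧸ I)) [hP : P.IsMaximal] :
      ((d : ℕ∞) : WithBot ℕ∞) ≤ ringKrullDim (Localization.AtPrime P) := by
    obtain ⟨rs, rfl, hm, hr⟩ := hex P hP
    exact hlen P rs hm hr
  have hI' := Ideal.Quotient.nontrivial_iff.mpr hI
  refine ⟨fun P hP ↦ ?_, le_antisymm hd ?_⟩
  · have heq : ringKrullDim (Localization.AtPrime P) = ((d : ℕ∞) : WithBot ℕ∞) :=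
      le_antisymm ((hloc P).trans hd) (hge P)
    rw [heq]
    congr 1
    refine le_antisymm (sSup_le ?_) (le_sSup ?_)
    · rintro _ ⟨rs, rfl, hm, hr⟩
      have := hlen P rs hm hr
      rwa [heq, WithBot.coe_le_coe] at this
    · obtain ⟨rs, hl, hm, hr⟩ := hex P hP
      exact ⟨rs, by rw [hl], hm, hr⟩
  · obtain ⟨P, hP⟩ := Ideal.exists_maximal (S ⧸ I)
    exact (hge P).trans (hloc P)

theorem ringKrullDim_quotient_le_of_forall_isPrime {S : Type*} [CommRing S] {I : Ideal S}
    {d : WithBot ℕ∞} (h : ∀ p : Ideal S, p.IsPrime → I ≤ p → ringKrullDim (S ⧸ p) ≤ d) :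
    ringKrullDim (S ⧸ I) ≤ d := by
  rw [ringKrullDim_quotient]
  refine iSup_le fun l ↦ ?_
  refine le_trans ?_ (h l.head.1.asIdeal l.head.1.2 l.head.2)
  rw [ringKrullDim_quotient]
  let l' : LTSeries (PrimeSpectrum.zeroLocus (l.head.1.asIdeal : Set S)) :=
    { length := l.length
      toFun := fun i ↦ ⟨(l i).1, show l.head.1 ≤ (l i).1 from l.head_le i⟩
      step := fun i ↦ l.step i }
  exact Order.LTSeries.length_le_krullDim l'

theorem MvPolynomial.ringKrullDim_quotient_le_of_X_mem {σ K : Type*} [Field K] [Finite σ]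
    {p : Ideal (MvPolynomial σ K)} {T : Finset σ} (hT : ∀ v ∈ T, X v ∈ p) :
    ringKrullDim (MvPolynomial σ K ⧸ p) ≤ (Nat.card σ - T.card : ℕ) := by
  classical
  have := Fintype.ofFinite σ
  let φ : MvPolynomial {v // v ∉ T} K →+* MvPolynomial σ K ⧸ p :=
    (Ideal.Quotient.mk p).comp (rename Subtype.val).toRingHom
  have hφ : Function.Surjective φ := by
    intro x
    obtain ⟨x, rfl⟩ := Ideal.Quotient.mk_surjective x
    induction x using MvPolynomial.induction_on with
    | C a => exact ⟨C a, by simp [φ]⟩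
    | add f g hf hg =>
      obtain ⟨f', hf⟩ := hf
      obtain ⟨g', hg⟩ := hg
      exact ⟨f' + g', by rw [map_add, map_add, hf, hg]⟩
    | mul_X f v hf =>
      obtain ⟨f', hf⟩ := hf
      by_cases hv : v ∈ T
      · exact ⟨0, by rw [map_mul, Ideal.Quotient.eq_zero_iff_mem.mpr (hT v hv)]; simp⟩
      · exact ⟨f' * X ⟨v, hv⟩, by rw [map_mul, map_mul, hf]; simp [φ]⟩
  refine (ringKrullDim_le_of_surjective φ hφ).trans ?_
  rw [ringKrullDim_of_isNoetherianRing, ringKrullDim_eq_zero_of_field, zero_add]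
  simp [Fintype.card_subtype_compl]

open RingTheory.Sequence in
theorem extVanishesBelow_quotient_iff {S : Type u} [CommRing S] [IsNoetherianRing S] {P J : Ideal S}
    (hP : P ≠ ⊤) (hJ : J ≤ P) {d : ℕ} : ExtVanishesBelow P d (S ⧸ J) ↔
      ∃ rs : List S, rs.length = d ∧ (∀ x ∈ rs, x ∈ P) ∧ IsRegular (S ⧸ J) rs := by
  have hsupp : Module.support S (ModuleCat.of S (S ⧸ P)) = PrimeSpectrum.zeroLocus P := by
    rw [Module.support_eq_zeroLocus]
    exact congrArg (fun I : Ideal S ↦ PrimeSpectrum.zeroLocus (I : Set S)) Ideal.annihilator_quotient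
  have hlt : P • (⊤ : Submodule S (ModuleCat.of S (S ⧸ J))) < ⊤ := by
    refine lt_top_iff_ne_top.mpr fun h ↦ hP ?_
    have hle : P • (⊤ : Submodule S (S ⧸ J)) ≤ Submodule.map J.mkQ P := by
      refine Submodule.smul_le.mpr fun x hx z _ ↦ ?_
      obtain ⟨z, rfl⟩ := Ideal.Quotient.mk_surjective z
      exact ⟨x * z, P.mul_mem_right z hx, rfl⟩
    have h₁ : Submodule.map J.mkQ P = ⊤ := top_le_iff.mp (h.symm.le.trans hle)
    rw [Submodule.map_mkQ_eq_top] at h₁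
    rwa [sup_eq_right.mpr hJ] at h₁
  constructor
  · intro h
    exact ModuleCat.exists_isRegular_of_exists_subsingleton_ext P d (ModuleCat.of S (S ⧸ J)) hlt
      (ModuleCat.of S (S ⧸ P)) hsupp h
  · rintro ⟨rs, rfl, hm, hr⟩
    exact ModuleCat.subsingleton_ext_of_exists_isRegular P (ModuleCat.of S (S ⧸ P)) hsupp.le
      (ModuleCat.of S (S ⧸ J)) hlt rs hm hr

theorem exists_finset_of_chainIdeal_le {R σ : Type*} [CommRing R] [DecidableEq σ] {p : Ideal R}
    [hp : p.IsPrime] {y : ℕ → ℕ → R} {x : σ → R} {ℓ : σ → ℕ} {μ : ℕ → ℕ} {r N : ℕ}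
    (hy : ∀ k < r, ∀ t < N, y k t ∈ p → ∃ v, ℓ v = t + μ k ∧ x v ∈ p)
    (hμ : MonotoneOn μ (Set.Iio r))
    {k : ℕ} (hk : k ≤ r) {t : ℕ} (ht : t ≤ N) (h : chainIdeal y k t ≤ p) :
    ∃ T : Finset σ, T.card = t ∧ ∀ v ∈ T, x v ∈ p ∧ ∃ j < k, ℓ v < t + μ j := by
  induction k generalizing t with
  | zero => exact absurd (top_le_iff.mp ((chainIdeal_zero y t).ge.trans h)) hp.ne_top
  | succ k ihk =>
    induction t with
    | zero => exact ⟨∅, by simp⟩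
    | succ t iht =>
      rw [chainIdeal_succ_succ, sup_le_iff, hp.mul_le, Ideal.span_singleton_le_iff_mem] at h
      obtain hyp | hle := h.2
      · obtain ⟨T, hT, hTp⟩ := iht (by omega) h.1
        obtain ⟨v, hv, hvp⟩ := hy k (by omega) t (by omega) hyp
        refine ⟨insert v T, ?_, ?_⟩
        · rw [Finset.card_insert_of_notMem, hT]
          intro hvT
          obtain ⟨-, j, hj, hlt⟩ := hTp v hvT
          have := hμ (a := j) (b := k) (Set.mem_Iio.mpr (by omega)) (Set.mem_Iio.mpr (by omega))
            (by omega)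
          omega
        · intro w hw
          obtain rfl | hw := Finset.mem_insert.mp hw
          · exact ⟨hvp, k, by omega, by omega⟩
          · obtain ⟨hwp, j, hj, hlt⟩ := hTp w hw
            exact ⟨hwp, j, hj, by omega⟩
      · obtain ⟨T, hT, hTp⟩ := ihk (by omega) ht hle
        refine ⟨T, hT, fun v hv ↦ ?_⟩
        obtain ⟨hvp, j, hj, hlt⟩ := hTp v hv
        exact ⟨hvp, j, by omega, hlt⟩

/-- The quotient of a polynomial ring in finitely many variables by a proper ideal
`chainIdeal y r N` is Cohen–Macaulay of codimension `N`, if each `y k t` is regular modulo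
`chainIdeal y (k + 1) t`, and every prime ideal containing `y k t` contains a variable of level
`t + μ k`. -/
theorem MvPolynomial.isCohenMacaulayRing_quotient_chainIdeal {σ K : Type*} [Field K] [Finite σ]
    {y : ℕ → ℕ → MvPolynomial σ K} {ℓ : σ → ℕ} {μ : ℕ → ℕ} {r N : ℕ}
    (hμ : MonotoneOn μ (Set.Iio r))
    (hreg : ∀ k < r, ∀ t < N, ∀ f, y k t * f ∈ chainIdeal y (k + 1) t → f ∈ chainIdeal y (k + 1) t)
    (hmem : ∀ p : Ideal (MvPolynomial σ K), p.IsPrime → ∀ k < r, ∀ t < N, y k t ∈ p →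
      ∃ v, ℓ v = t + μ k ∧ X v ∈ p)
    (hN : N ≤ Nat.card σ) (hI : chainIdeal y r N ≠ ⊤) :
    IsCohenMacaulayRing (MvPolynomial σ K ⧸ chainIdeal y r N) ∧
      ringKrullDim (MvPolynomial σ K ⧸ chainIdeal y r N) = (Nat.card σ - N : ℕ) := by
  classical
  refine isCohenMacaulayRing_quotient_of_exists_isRegular hI ?_ fun P hP hIP ↦ ?_
  · refine ringKrullDim_quotient_le_of_forall_isPrime fun p hp hIp ↦ ?_
    obtain ⟨T, rfl, hT⟩ := exists_finset_of_chainIdeal_le (hmem p hp) hμ le_rfl le_rfl hIp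
    exact ringKrullDim_quotient_le_of_X_mem fun v hv ↦ (hT v hv).1
  · rw [← extVanishesBelow_quotient_iff hP.ne_top hIP]
    refine ExtVanishesBelow.quotient_chainIdeal ?_ hreg le_rfl le_rfl (Nat.sub_add_cancel hN)
    rw [extVanishesBelow_quotient_iff hP.ne_top bot_le]
    obtain ⟨rs, hl, hm, hr⟩ := exists_isRegular_of_isMaximal P
    exact ⟨rs, hl, hm, ((Submodule.quotEquivOfEqBot _ rfl).isRegular_congr rs).mpr hr⟩

section colVar

variable (K : Type*) [Field K] {c : ℕ} (n : ℕ)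

/-- The variable `x_{i,j}` of `K[X_n]`, or `0` if `j` is not one of the columns `1, …, n`. -/
noncomputable def colVar (i : Fin c) (j : ℕ) : MvPolynomial (Fin c × ColIdx n) K :=
  if h : j ∈ Finset.Icc 1 n then X (i, ⟨j, h⟩) else 0

variable {n} in
theorem colVar_of_mem (i : Fin c) {j : ℕ} (h : j ∈ Finset.Icc 1 n) :
    colVar K n i j = X (i, ⟨j, h⟩) := dif_pos h

theorem colVar_mem_supported {T : Set (Fin c × ColIdx n)} {i : Fin c} {j : ℕ}
    (h : ∀ h : j ∈ Finset.Icc 1 n, (i, ⟨j, h⟩) ∈ T) : colVar K n i j ∈ supported K T := by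
  rw [colVar]
  split_ifs with hj
  · exact X_mem_supported.mpr (h hj)
  · exact zero_mem _

/-- The column of `x^a` at index `μ k`, shifted by `t`. -/
noncomputable def colMonomial (μ : ℕ → ℕ) (a : Fin c → ℕ → ℕ) (k t : ℕ) :
    MvPolynomial (Fin c × ColIdx n) K :=
  ∏ i, colVar K n i (t + μ k) ^ a i (μ k)

variable {μ : ℕ → ℕ} {a : Fin c → ℕ → ℕ} {r : ℕ}

theorem prod_Icc_pow_eq_prod_range {R : Type*} [CommMonoid R] (hr : 1 ≤ r)
    (hμ : StrictMonoOn μ (Set.Iio r)) (hμ1 : ∀ k < r, 1 ≤ μ k)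
    (ha : ∀ i j, a i j ≠ 0 → ∃ k < r, j = μ k) (F : Fin c → ℕ → R) :
    ∏ i, ∏ j ∈ Finset.Icc 1 (μ (r - 1)), F i j ^ a i j =
      ∏ k ∈ Finset.range r, ∏ i, F i (μ k) ^ a i (μ k) := by
  rw [Finset.prod_comm]
  rw [← Finset.prod_image (s := Finset.range r) (g := μ)
    (f := fun j ↦ ∏ i, F i j ^ a i j)
    (fun i hi j hj ↦ hμ.injOn (by simpa using hi) (by simpa using hj))]
  refine (Finset.prod_subset ?_ ?_).symm
  · intro j hj
    obtain ⟨k, hk, rfl⟩ := Finset.mem_image.mp hj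
    rw [Finset.mem_range] at hk
    exact Finset.mem_Icc.mpr ⟨hμ1 k hk, hμ.monotoneOn (Set.mem_Iio.mpr hk)
      (Set.mem_Iio.mpr (by omega)) (by omega)⟩
  · intro j _ hj
    refine Finset.prod_eq_one fun i _ ↦ ?_
    by_cases h : a i j = 0
    · rw [h, pow_zero]
    · obtain ⟨k, hk, rfl⟩ := ha i j h
      exact absurd (Finset.mem_image_of_mem μ (Finset.mem_range.mpr hk)) hj

theorem rename_orbMonC_s12 (hr : 1 ≤ r)
    (hμ : StrictMonoOn μ (Set.Iio r)) (hμ1 : ∀ k < r, 1 ≤ μ k)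
    (ha : ∀ i j, a i j ≠ 0 → ∃ k < r, j = μ k) (π : ℕ → ℕ) :
    rename (fun p ↦ (p.1, π p.2)) (orbMonC K c r μ a) =
      ∏ k ∈ Finset.range r, ∏ i, (X (i, π (μ k)) : MvPolynomial (Fin c × ℕ) K) ^ a i (μ k) := by
  rw [orbMonC, ← prod_Icc_pow_eq_prod_range hr hμ hμ1 ha (fun i j ↦ X (i, π j))]
  simp

variable (c) in
/-- The retraction of `toBigC` sending the variables outside the columns `1, …, n` to `0`. -/
noncomputable def ofBigC : MvPolynomial (Fin c × ℕ) K →ₐ[K] MvPolynomial (Fin c × ColIdx n) K :=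
  aeval fun p ↦ colVar K n p.1 p.2

theorem ofBigC_toBigC (f : MvPolynomial (Fin c × ColIdx n) K) :
    ofBigC K c n (toBigC K c n f) = f := by
  rw [ofBigC, toBigC, aeval_rename]
  suffices (fun p : Fin c × ColIdx n ↦ colVar K n p.1 p.2.1) = X by
    exact (congrArg (fun g ↦ aeval g f) this).trans (by simp)
  ext1 p
  exact colVar_of_mem K p.1 p.2.2

variable {n} in
theorem toBigC_colVar (i : Fin c) {j : ℕ} (h : j ∈ Finset.Icc 1 n) :
    toBigC K c n (colVar K n i j) = X (i, j) := by
  rw [colVar_of_mem K i h, toBigC, rename_X]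

/-- Every weakly increasing sequence of shifts is realised by a strictly increasing map. -/
theorem exists_strictMono_apply_eq_add {q : ℕ → ℕ} (hμ : StrictMonoOn μ (Set.Iio r))
    (hq : MonotoneOn q (Set.Iio r)) :
    ∃ π : ℕ → ℕ, StrictMono π ∧ ∀ k < r, π (μ k) = q k + μ k := by
  refine ⟨fun j ↦ (Finset.range r).sup (fun k ↦ if μ k ≤ j then q k else 0) + j, ?_, ?_⟩
  · refine Monotone.add_strictMono (fun i j hij ↦ Finset.sup_mono_fun fun k _ ↦ ?_) strictMono_id
    split_ifs <;> omega
  · intro k hk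
    rw [Nat.add_right_cancel_iff]
    apply le_antisymm
    · refine Finset.sup_le fun l hl ↦ ?_
      rw [Finset.mem_range] at hl
      split_ifs with h
      · exact hq (Set.mem_Iio.mpr hl) (Set.mem_Iio.mpr hk) ((hμ.le_iff_le hl hk).mp h)
      · exact Nat.zero_le _
    · refine le_trans ?_ (Finset.le_sup (Finset.mem_range.mpr hk))
      rw [if_pos le_rfl]

theorem restrC_orbitIdealC_eq_chainIdeal (hr : 1 ≤ r)
    (hμ : StrictMonoOn μ (Set.Iio r)) (hμ1 : ∀ k < r, 1 ≤ μ k)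
    (ha : ∀ j, (∃ i, a i j ≠ 0) ↔ ∃ k, k < r ∧ j = μ k) (hn : μ (r - 1) ≤ n) :
    restrC K (orbitIdealC K (orbMonC K c r μ a)) n =
      chainIdeal (colMonomial K n μ a) r (n - μ (r - 1) + 1) := by
  have ha' : ∀ i j, a i j ≠ 0 → ∃ k < r, j = μ k := fun i j h ↦ (ha j).mp ⟨i, h⟩
  apply le_antisymm
  · intro f hf
    rw [← ofBigC_toBigC K n f]
    suffices orbitIdealC K (orbMonC K c r μ a) ≤
        (chainIdeal (colMonomial K n μ a) r (n - μ (r - 1) + 1)).comap (ofBigC K c n) from this hf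
    refine Ideal.span_le.mpr ?_
    rintro _ ⟨π, hπ, rfl⟩
    have hle (j) : j ≤ π j := hπ.le_apply
    have heq : ofBigC K c n (rename (fun p ↦ (p.1, π p.2)) (orbMonC K c r μ a)) =
        ∏ k ∈ Finset.range r, colMonomial K n μ a k (π (μ k) - μ k) := by
      rw [rename_orbMonC_s12 K hr hμ hμ1 ha', map_prod]
      refine Finset.prod_congr rfl fun k _ ↦ ?_
      simp [colMonomial, ofBigC, Nat.sub_add_cancel (hle _)]
    have hmono : MonotoneOn (fun k ↦ π (μ k) - μ k) (Set.Iio r) := by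
      intro i hi j hj hij
      have h := hμ.monotoneOn hi hj hij
      have := hπ.add_le_nat (μ j - μ i) (μ i)
      rw [Nat.sub_add_cancel h] at this
      have := hle (μ i)
      dsimp only
      omega
    rw [SetLike.mem_coe, Ideal.mem_comap, heq]
    by_cases h : π (μ (r - 1)) ≤ n
    · refine Ideal.subset_span ⟨_, hmono, fun i hi ↦ ?_, rfl⟩
      have := hmono (Set.mem_Iio.mpr hi) (Set.mem_Iio.mpr (by omega : r - 1 < r)) (by omega)
      dsimp only at this
      omega
    · rw [Finset.prod_eq_zero (Finset.mem_range.mpr (by omega : r - 1 < r))]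
      · exact zero_mem _
      · obtain ⟨i, hi⟩ := (ha (μ (r - 1))).mpr ⟨r - 1, by omega, rfl⟩
        refine Finset.prod_eq_zero (Finset.mem_univ i) ?_
        rw [Nat.sub_add_cancel (hle _), colVar, dif_neg (by simp; omega), zero_pow hi]
  · refine Ideal.span_le.mpr ?_
    rintro _ ⟨q, hq, hqN, rfl⟩
    obtain ⟨π, hπ, hπq⟩ := exists_strictMono_apply_eq_add hμ hq
    refine Ideal.subset_span ⟨π, hπ, ?_⟩
    rw [rename_orbMonC_s12 K hr hμ hμ1 ha']
    rw [map_prod]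
    refine Finset.prod_congr rfl fun k hk ↦ ?_
    rw [Finset.mem_range] at hk
    rw [colMonomial, map_prod]
    refine Finset.prod_congr rfl fun i _ ↦ ?_
    have := hqN k hk
    have := hμ1 k hk
    have : μ k ≤ μ (r - 1) := hμ.monotoneOn (Set.mem_Iio.mpr hk)
      (Set.mem_Iio.mpr (by omega)) (by omega)
    rw [map_pow, toBigC_colVar K i (Finset.mem_Icc.mpr ⟨by omega, by omega⟩), hπq k hk]

theorem mem_chainIdeal_of_colMonomial_mul_mem (hμ : StrictMonoOn μ (Set.Iio r))
    (hμ1 : ∀ k < r, 1 ≤ μ k) {k t : ℕ} (hk : k < r) (ht : t + μ k ≤ n)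
    {f : MvPolynomial (Fin c × ColIdx n) K}
    (hf : colMonomial K n μ a k t * f ∈ chainIdeal (colMonomial K n μ a) (k + 1) t) :
    f ∈ chainIdeal (colMonomial K n μ a) (k + 1) t := by
  refine mem_span_of_mul_mem_span_of_supported (T := {v | v.2.1 < t + μ k}) ?_ ?_ ?_ hf
  · rintro _ ⟨q, -, hq, rfl⟩
    refine Subalgebra.prod_mem _ fun j hj ↦ Subalgebra.prod_mem _ fun i _ ↦
      Subalgebra.pow_mem _ (colVar_mem_supported K n fun _ ↦ ?_) _
    rw [Finset.mem_range] at hj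
    have := hμ.monotoneOn (Set.mem_Iio.mpr (by omega : j < r)) (Set.mem_Iio.mpr hk) (by omega)
    have := hq j hj
    change q j + μ j < t + μ k
    omega
  · refine Subalgebra.prod_mem _ fun i _ ↦
      Subalgebra.pow_mem _ (colVar_mem_supported K n fun _ ↦ ?_) _
    simp
  · refine Finset.prod_ne_zero_iff.mpr fun i _ ↦ pow_ne_zero _ ?_
    have := hμ1 k hk
    rw [colVar_of_mem K i (Finset.mem_Icc.mpr ⟨by omega, ht⟩)]
    exact X_ne_zero _

theorem exists_X_mem_of_colMonomial_mem {p : Ideal (MvPolynomial (Fin c × ColIdx n) K)}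
    [hp : p.IsPrime] (hμ1 : ∀ k < r, 1 ≤ μ k) {k t : ℕ} (hk : k < r) (ht : t + μ k ≤ n)
    (h : colMonomial K n μ a k t ∈ p) : ∃ v, v.2.1 = t + μ k ∧ X v ∈ p := by
  obtain ⟨i, -, hi⟩ := (Ideal.IsPrime.prod_mem_iff).mp h
  have := hμ1 k hk
  have hi := hp.mem_of_pow_mem _ hi
  rw [colVar_of_mem K i (Finset.mem_Icc.mpr ⟨by omega, ht⟩)] at hi
  exact ⟨_, rfl, hi⟩

theorem chainIdeal_colMonomial_ne_top (hr : 1 ≤ r) (ha : ∃ i, a i (μ 0) ≠ 0) (N : ℕ) :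
    chainIdeal (colMonomial K n μ a) r N ≠ ⊤ := by
  suffices chainIdeal (colMonomial K n μ a) r N ≤ RingHom.ker (constantCoeff (R := K)) from
    fun h ↦ RingHom.ker_ne_top _ (top_le_iff.mp (h.symm.le.trans this))
  refine Ideal.span_le.mpr ?_
  rintro _ ⟨q, -, -, rfl⟩
  obtain ⟨i, hi⟩ := ha
  change constantCoeff _ = 0
  rw [map_prod, Finset.prod_eq_zero (Finset.mem_range.mpr hr)]
  rw [colMonomial, map_prod, Finset.prod_eq_zero (Finset.mem_univ i)]
  rw [map_pow, colVar]
  split_ifs <;> simp [hi]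

end colVar

/-- For `n ≥ μ_r`, `A_n = K[X_n]/I_n` is a Cohen–Macaulay ring of Krull
dimension `n(c-1) + μ_r - 1`. -/
theorem statement12 (K : Type*) [Field K] (c : ℕ) (hc : 1 ≤ c) (r : ℕ) (hr : 1 ≤ r)
    (μ : ℕ → ℕ) (hμ1 : 1 ≤ μ 0) (hμ : ∀ j, j + 1 < r → μ j < μ (j + 1))
    (a : Fin c → ℕ → ℕ) (hcols : ∀ j : ℕ, (∃ i, a i j ≠ 0) ↔ ∃ k, k < r ∧ j = μ k)
    (n : ℕ) (hn : μ (r - 1) ≤ n) :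
    IsCohenMacaulayRing
        (MvPolynomial (Fin c × ColIdx n) K ⧸ restrC K (orbitIdealC K (orbMonC K c r μ a)) n) ∧
      ringKrullDim
          (MvPolynomial (Fin c × ColIdx n) K ⧸
            restrC K (orbitIdealC K (orbMonC K c r μ a)) n) =
        ((n * (c - 1) + μ (r - 1) - 1 : ℕ) : WithBot (WithTop ℕ)) := by
  have hμ' : StrictMonoOn μ (Set.Iio r) :=
    strictMonoOn_of_lt_add_one Set.ordConnected_Iio fun j _ _ hj ↦ hμ j hj
  have hμ1' (k : ℕ) (hk : k < r) : 1 ≤ μ k :=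
    hμ1.trans (hμ'.monotoneOn (Set.mem_Iio.mpr (by omega)) (Set.mem_Iio.mpr hk) (Nat.zero_le k))
  have hle (k : ℕ) (hk : k < r) : μ k ≤ μ (r - 1) :=
    hμ'.monotoneOn (Set.mem_Iio.mpr hk) (Set.mem_Iio.mpr (by omega)) (by omega)
  have hcard : Nat.card (Fin c × ColIdx n) = n * (c - 1) + n := by
    obtain ⟨c, rfl⟩ := Nat.exists_eq_add_of_le' hc
    simp [mul_comm, Nat.mul_succ]
  have hpos := hμ1' (r - 1) (by omega)
  have hdim : n * (c - 1) + μ (r - 1) - 1 =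
      Nat.card (Fin c × ColIdx n) - (n - μ (r - 1) + 1) := by
    omega
  rw [restrC_orbitIdealC_eq_chainIdeal K n hr hμ' hμ1' hcols hn, hdim]
  refine isCohenMacaulayRing_quotient_chainIdeal (ℓ := fun v ↦ v.2.1) hμ'.monotoneOn ?_ ?_
    (by omega) (chainIdeal_colMonomial_ne_top K n hr ((hcols _).mpr ⟨0, by omega, rfl⟩) _)
  · intro k hk t ht f hf
    have := hle k hk
    exact mem_chainIdeal_of_colMonomial_mul_mem K n hμ' hμ1' hk (by omega) hf
  · intro p hp k hk t ht h
    have := hle k hk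
    exact exists_X_mem_of_colMonomial_mem K n hμ1' hk (by omega) h
end

section
/- Assume r ≥ 2, set δ_r = μ_r − μ_{r−1} and b_r = Σ_{i=1}^{c} a_{i,μ_r}. For every n ≥ δ_r, the following identity of formal power series in ℤ[[t]] holds: (1−t)^{cδ_r} · H_{A_n}(t) = (1−t)^{c(δ_r−1)} · (1 − t^{b_r}) · H_{A_{n−1}}(t) + t^{b_r} · H_{B_{n−δ_r}}(t). (Equivalently, H_{A_n}(t) = (1−t^{b_r})/(1−t)^c · H_{A_{n−1}}(t) + t^{b_r}/(1−t)^{cδ_r} · H_{B_{n−δ_r}}(t).) -/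
open MvPolynomial

open Classical in
/-- The generating series, by degree, of the exponents supported on `s` that satisfy `P`. -/
noncomputable def exponentSeries {ι : Type*} (s : Finset ι) (P : (ι →₀ ℕ) → Prop) :
    PowerSeries ℤ :=
  PowerSeries.mk fun j => ((((s.finsuppAntidiag j).filter P).card : ℕ) : ℤ)

namespace exponentSeries

variable {ι : Type*}

theorem congr {s : Finset ι} {P Q : (ι →₀ ℕ) → Prop}
    (h : ∀ d : ι →₀ ℕ, d.support ⊆ s → (P d ↔ Q d)) :
    exponentSeries s P = exponentSeries s Q := by
  classical
  ext j
  simp only [exponentSeries, PowerSeries.coeff_mk]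
  congr 2
  refine Finset.filter_congr fun d hd => h d ?_
  exact (Finset.mem_finsuppAntidiag.1 hd).2

theorem and_add_and_not (s : Finset ι) (P Q : (ι →₀ ℕ) → Prop) :
    exponentSeries s P =
      exponentSeries s (fun d => P d ∧ Q d) + exponentSeries s (fun d => P d ∧ ¬ Q d) := by
  classical
  ext j
  simp only [exponentSeries, PowerSeries.coeff_mk, map_add]
  norm_cast
  rw [← Finset.card_filter_add_card_filter_not (s := (s.finsuppAntidiag j).filter P) Q,
    Finset.filter_filter, Finset.filter_filter]
  congr!

theorem mul [DecidableEq ι] {s t : Finset ι} (hst : Disjoint s t)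
    {P Q R : (ι →₀ ℕ) → Prop}
    (hR : ∀ d : ι →₀ ℕ, d.support ⊆ s ∪ t →
      (R d ↔ P (d.filter (· ∈ s)) ∧ Q (d.filter (· ∈ t)))) :
    exponentSeries (s ∪ t) R = exponentSeries s P * exponentSeries t Q := by
  classical
  ext j
  rw [PowerSeries.coeff_mul]
  simp only [exponentSeries, PowerSeries.coeff_mk]
  norm_cast
  simp only [← Finset.card_product]
  rw [← Finset.card_sigma]
  have hts : ∀ x ∈ t, x ∉ s := fun x hx hx' => Finset.disjoint_left.1 hst hx' hx
  have hfil : ∀ (e f : ι →₀ ℕ), e.support ⊆ s → f.support ⊆ t →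
      (e + f).filter (· ∈ s) = e ∧ (e + f).filter (· ∈ t) = f := by
    intro e f he hf
    constructor
    · ext x
      by_cases hx : x ∈ s
      · have : f x = 0 := by
          by_contra h
          exact hts x (hf (Finsupp.mem_support_iff.2 h)) hx
        simp [hx, this]
      · have : e x = 0 := by
          by_contra h
          exact hx (he (Finsupp.mem_support_iff.2 h))
        simp [hx, this]
    · ext x
      by_cases hx : x ∈ t
      · have : e x = 0 := by
          by_contra h
          exact hts x hx (he (Finsupp.mem_support_iff.2 h))
        simp [hx, this]
      · have : f x = 0 := by
          by_contra h
          exact hx (hf (Finsupp.mem_support_iff.2 h))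
        simp [hx, this]
  have hsum : ∀ d : ι →₀ ℕ, d.support ⊆ s ∪ t →
      d.filter (· ∈ s) + d.filter (· ∈ t) = d := by
    intro d hd
    ext x
    by_cases hx : x ∈ s
    · have : x ∉ t := fun h => hts x h hx
      simp [hx, this]
    · by_cases hx' : x ∈ t
      · simp [hx, hx']
      · have : d x = 0 := by
          by_contra h
          rcases Finset.mem_union.1 (hd (Finsupp.mem_support_iff.2 h)) with h | h
          exacts [hx h, hx' h]
        simp [hx, hx', this]
  have hsub : ∀ (d : ι →₀ ℕ) (u : Finset ι), (d.filter (· ∈ u)).support ⊆ u := by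
    intro d u x hx
    simp only [Finsupp.support_filter, Finset.mem_filter] at hx
    exact hx.2
  have hdeg : ∀ (d : ι →₀ ℕ) (u : Finset ι), u.sum (d.filter (· ∈ u)) = u.sum d := fun d u =>
    Finset.sum_congr rfl fun x hx => by simp [hx]
  refine Finset.card_nbij'
    (fun d => ⟨(s.sum d, t.sum d), (d.filter (· ∈ s), d.filter (· ∈ t))⟩)
    (fun x => x.2.1 + x.2.2) ?_ ?_ ?_ ?_
  · intro d hd
    simp only [Finset.coe_filter, Finset.mem_finsuppAntidiag, Set.mem_ofPred_eq] at hd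
    obtain ⟨⟨h1, h2⟩, h3⟩ := hd
    rw [Finset.sum_union hst] at h1
    simp [h1, hsub, hdeg, ((hR d h2).1 h3).1, ((hR d h2).1 h3).2, -Finsupp.support_filter]
  · rintro ⟨⟨k, l⟩, e, f⟩ h
    simp only [Finset.coe_sigma, Set.mem_sigma_iff, Finset.mem_coe,
      Finset.mem_product, Finset.mem_filter, Finset.mem_finsuppAntidiag] at h
    obtain ⟨h1, ⟨⟨h2, h3⟩, h4⟩, ⟨h5, h6⟩, h7⟩ := h
    have hs : (e + f).support ⊆ s ∪ t :=
      Finsupp.support_add.trans (Finset.union_subset_union h3 h6)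
    obtain ⟨he, hf⟩ := hfil e f h3 h6
    simp only [Finset.coe_filter, Finset.mem_finsuppAntidiag, Set.mem_ofPred_eq]
    refine ⟨⟨?_, hs⟩, (hR _ hs).2 (by rw [he, hf]; exact ⟨h4, h7⟩)⟩
    rw [Finset.sum_union hst, ← hdeg _ s, ← hdeg _ t, he, hf, h2, h5]
    exact Finset.HasAntidiagonal.mem_antidiagonal.1 h1
  · intro d hd
    simp only [Finset.coe_filter, Finset.mem_finsuppAntidiag, Set.mem_ofPred_eq] at hd
    exact hsum d hd.1.2
  · rintro ⟨⟨k, l⟩, e, f⟩ h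
    simp only [Finset.coe_sigma, Set.mem_sigma_iff, Finset.mem_coe,
      Finset.mem_product, Finset.mem_filter, Finset.mem_finsuppAntidiag] at h
    obtain ⟨h1, ⟨⟨h2, h3⟩, h4⟩, ⟨h5, h6⟩, h7⟩ := h
    obtain ⟨he, hf⟩ := hfil e f h3 h6
    have hk : s.sum ⇑(e + f) = k := by rw [← hdeg, he, h2]
    have hl : t.sum ⇑(e + f) = l := by rw [← hdeg, hf, h5]
    simp only [hk, hl, he, hf]

theorem one_sub_X_pow_card_mul (s : Finset ι) :
    (1 - PowerSeries.X : PowerSeries ℤ) ^ s.card * exponentSeries s (fun _ => True) = 1 := by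
  classical
  induction s using Finset.induction_on with
  | empty =>
    ext j
    by_cases hj : j = 0 <;>
      simp [exponentSeries, hj, Finset.finsuppAntidiag_empty, PowerSeries.coeff_one]
  | insert x s hx ih =>
    have hsingle : exponentSeries {x} (fun _ => True) = PowerSeries.mk 1 := by
      ext j
      simp only [exponentSeries, PowerSeries.coeff_mk, Finset.filter_true, Pi.one_apply]
      norm_cast
      rw [Finset.card_eq_one]
      refine ⟨Finsupp.single x j, ?_⟩
      ext d
      simp only [Finset.mem_finsuppAntidiag, Finset.sum_singleton, Finset.mem_singleton]
      constructor
      · rintro ⟨h1, h2⟩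
        rw [Finsupp.support_subset_singleton.1 h2, h1]
      · rintro rfl
        exact ⟨by simp, Finsupp.support_single_subset⟩
    rw [Finset.insert_eq, mul (P := fun _ => True) (Q := fun _ => True)
      (Finset.disjoint_singleton_left.2 hx) (by simp), ← Finset.insert_eq,
      Finset.card_insert_of_notMem hx, hsingle, pow_succ]
    have h := PowerSeries.mk_one_mul_one_sub_eq_one ℤ
    linear_combination (exponentSeries s (fun _ => True) * (1 - PowerSeries.X) ^ s.card) * h + ih

theorem le_eq_X_pow_mul {s : Finset ι} {w : ι →₀ ℕ} (hw : w.support ⊆ s) :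
    exponentSeries s (w ≤ ·) =
      PowerSeries.X ^ (s.sum w) * exponentSeries s (fun _ => True) := by
  classical
  ext j
  rw [PowerSeries.coeff_X_pow_mul']
  simp only [exponentSeries, PowerSeries.coeff_mk, Finset.filter_true]
  split_ifs with h
  · norm_cast
    refine Finset.card_nbij' (· - w) (· + w) ?_ ?_ ?_ ?_
    · intro d hd
      simp only [Finset.coe_filter, Finset.mem_finsuppAntidiag, Set.mem_ofPred_eq,
        Finset.mem_coe] at hd ⊢
      refine ⟨?_, fun x hx => hd.1.2 ?_⟩
      · rw [← hd.1.1, ← Finset.sum_tsub_distrib s fun x _ => hd.2 x]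
        rfl
      · simp only [Finsupp.mem_support_iff, Finsupp.coe_tsub, Pi.sub_apply] at hx ⊢
        omega
    · intro d hd
      simp only [Finset.coe_filter, Finset.mem_finsuppAntidiag, Set.mem_ofPred_eq,
        Finset.mem_coe] at hd ⊢
      refine ⟨⟨?_, Finsupp.support_add.trans (Finset.union_subset hd.2 hw)⟩, le_add_self⟩
      simp only [Finsupp.coe_add, Pi.add_apply, Finset.sum_add_distrib]
      rw [hd.1]
      exact Nat.sub_add_cancel h
    · intro d hd
      simp only [Finset.coe_filter, Set.mem_ofPred_eq] at hd
      exact tsub_add_cancel_of_le hd.2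
    · intro d _
      exact add_tsub_cancel_right d w
  · norm_cast
    rw [Finset.card_eq_zero]
    ext d
    simp only [Finset.mem_filter, Finset.mem_finsuppAntidiag, Finset.notMem_empty, iff_false]
    rintro ⟨hd, hwd⟩
    exact h (hd.1 ▸ Finset.sum_le_sum fun x _ => hwd x)

end exponentSeries

theorem hseries_comap_rename {K : Type*} [Field K] {σ τ : Type*} {f : σ → τ}
    (hf : Function.Injective f) {I : Ideal (MvPolynomial τ K)} {N : (τ →₀ ℕ) → Prop}
    (hI : ∀ p, p ∈ I ↔ ∀ d ∈ p.support, ¬ N d) {s : Finset τ}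
    (hs : ∀ x, x ∈ s ↔ x ∈ Set.range f) :
    hseries K (I.comap (rename f : MvPolynomial σ K →ₐ[K] MvPolynomial τ K)) =
      exponentSeries s N := by
  classical
  ext j
  simp only [hseries, exponentSeries, PowerSeries.coeff_mk, hilbF]
  norm_cast
  set T := (s.finsuppAntidiag j).filter N with hT
  let φ : homogeneousSubmodule σ K j →ₗ[K] (T → K) :=
    LinearMap.pi fun e => lcoeff K e.1 ∘ₗ
      (rename f : MvPolynomial σ K →ₐ[K] MvPolynomial τ K).toLinearMap ∘ₗ
        (homogeneousSubmodule σ K j).subtype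
  have hφ : ∀ p e, φ p e = (rename f p.1).coeff e.1 := fun p e => rfl
  have hker : LinearMap.ker φ = Submodule.comap (homogeneousSubmodule σ K j).subtype
      (Submodule.restrictScalars K
        (I.comap (rename f : MvPolynomial σ K →ₐ[K] MvPolynomial τ K))) := by
    ext p
    simp only [LinearMap.mem_ker, Submodule.mem_comap, Submodule.restrictScalars_mem,
      Ideal.mem_comap, hI, Submodule.subtype_apply]
    constructor
    · intro h d hd hN
      refine mem_support_iff.1 hd ?_
      have hhom : (rename f p.1).IsHomogeneous j :=
        ((mem_homogeneousSubmodule j p.1).1 p.2).rename_isHomogeneous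
      have hdeg := hhom (mem_support_iff.1 hd)
      have hsupp : d.support ⊆ s := by
        rw [support_rename_of_injective hf] at hd
        obtain ⟨e, -, rfl⟩ := Finset.mem_image.1 hd
        intro x hx
        obtain ⟨y, -, rfl⟩ := Finset.mem_image.1 (Finsupp.mapDomain_support hx)
        exact (hs _).2 ⟨y, rfl⟩
      have hdT : d ∈ T := by
        rw [hT, Finset.mem_filter, Finset.mem_finsuppAntidiag']
        refine ⟨⟨?_, hsupp⟩, hN⟩
        exact (DFunLike.congr_fun Finsupp.degree_eq_weight_one d).trans hdeg
      exact congrFun h ⟨d, hdT⟩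
    · intro h
      ext e
      rw [hφ]
      by_contra hne
      exact h e.1 (mem_support_iff.2 hne) (Finset.mem_filter.1 e.2).2
  have hcomap : ∀ e : T, (Finsupp.comapDomain f e.1 hf.injOn).mapDomain f = e.1 := by
    intro e
    refine Finsupp.mapDomain_comapDomain f hf _ fun x hx => (hs x).1 ?_
    exact (Finset.mem_finsuppAntidiag.1 (Finset.mem_filter.1 e.2).1).2 hx
  have hsurj : Function.Surjective φ := by
    intro g
    refine ⟨⟨∑ e : T, monomial (Finsupp.comapDomain f e.1 hf.injOn) (g e), ?_⟩, ?_⟩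
    · refine Submodule.sum_mem _ fun e _ => ?_
      refine isHomogeneous_monomial _ ?_
      rw [← Finsupp.degree_mapDomain f, hcomap]
      exact (Finset.mem_finsuppAntidiag'.1 (Finset.mem_filter.1 e.2).1).1
    · ext e
      rw [hφ]
      simp only [map_sum, rename_monomial, hcomap, coeff_sum, coeff_monomial]
      rw [Finset.sum_eq_single e]
      · simp
      · intro e' _ hne
        rw [if_neg fun h => hne (Subtype.ext h)]
      · simp
  rw [← hker, (φ.quotKerEquivOfSurjective hsurj).finrank_eq, Module.finrank_fintype_fun_eq_card,
    Fintype.card_coe]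

/-- The exponent `d` is divisible by a shift, along some strictly increasing map of the columns, of
the exponent given by the columns `1, …, M` of `a`. -/
def OrbitDvd {c : ℕ} (a : Fin c → ℕ → ℕ) (M : ℕ) (d : Fin c × ℕ →₀ ℕ) : Prop :=
  ∃ π : ℕ → ℕ, StrictMono π ∧ ∀ i, ∀ j ∈ Finset.Icc 1 M, a i j ≤ d (i, π j)

theorem mem_orbitIdealC_orbMonC {K : Type*} [Field K] {c r : ℕ} {μ : ℕ → ℕ} {a : Fin c → ℕ → ℕ}
    (p : MvPolynomial (Fin c × ℕ) K) :
    p ∈ orbitIdealC K (orbMonC K c r μ a) ↔ ∀ d ∈ p.support, OrbitDvd a (μ (r - 1)) d := by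
  classical
  set w : Fin c × ℕ →₀ ℕ :=
    ∑ i : Fin c, ∑ j ∈ Finset.Icc 1 (μ (r - 1)), Finsupp.single (i, j) (a i j) with hw
  have hwapp : ∀ i j, w (i, j) = if j ∈ Finset.Icc 1 (μ (r - 1)) then a i j else 0 := by
    intro i j
    rw [hw, Finsupp.finsetSum_apply, Finset.sum_eq_single i, Finsupp.finsetSum_apply]
    · simp [Finsupp.single_apply]
    · intro i' _ hne
      simp [Finsupp.finsetSum_apply, hne]
    · simp
  have hmon : orbMonC K c r μ a = monomial w 1 := by
    simp only [orbMonC, hw, monomial_sum_one, X_pow_eq_monomial]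
  have hset : {q : MvPolynomial (Fin c × ℕ) K | ∃ π : ℕ → ℕ, StrictMono π ∧
      q = rename (fun p => (p.1, π p.2)) (orbMonC K c r μ a)} =
      (fun e => monomial e (1 : K)) ''
        {e | ∃ π : ℕ → ℕ, StrictMono π ∧ e = w.mapDomain fun p => (p.1, π p.2)} := by
    ext q
    simp only [hmon, rename_monomial, Set.mem_ofPred_eq, Set.mem_image]
    constructor
    · rintro ⟨π, hπ, rfl⟩
      exact ⟨_, ⟨π, hπ, rfl⟩, rfl⟩
    · rintro ⟨_, ⟨π, hπ, rfl⟩, rfl⟩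
      exact ⟨π, hπ, rfl⟩
  rw [orbitIdealC, hset, mem_ideal_span_monomial_image]
  refine forall₂_congr fun d _ => ?_
  simp only [Set.mem_ofPred_eq, OrbitDvd]
  constructor
  · rintro ⟨_, ⟨π, hπ, rfl⟩, hle⟩
    refine ⟨π, hπ, fun i j hj => ?_⟩
    have hinj : Function.Injective fun p : Fin c × ℕ => (p.1, π p.2) :=
      Function.injective_id.prodMap hπ.injective
    have := hle (i, π j)
    rwa [Finsupp.mapDomain_apply hinj w (i, j), hwapp, if_pos hj] at this
  · rintro ⟨π, hπ, hle⟩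
    have hinj : Function.Injective fun p : Fin c × ℕ => (p.1, π p.2) :=
      Function.injective_id.prodMap hπ.injective
    refine ⟨_, ⟨π, hπ, rfl⟩, fun x => ?_⟩
    by_cases hx : x ∈ Set.range fun p : Fin c × ℕ => (p.1, π p.2)
    · obtain ⟨⟨i, j⟩, rfl⟩ := hx
      rw [Finsupp.mapDomain_apply hinj w (i, j), hwapp]
      split_ifs with hj
      exacts [hle i j hj, Nat.zero_le _]
    · rw [Finsupp.mapDomain_of_notMem_range _ _ hx]
      exact Nat.zero_le _

theorem hseries_restrC_orbMonC (K : Type*) [Field K] (c r : ℕ) (μ : ℕ → ℕ) (a : Fin c → ℕ → ℕ)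
    (n : ℕ) :
    hseries K (restrC K (orbitIdealC K (orbMonC K c r μ a)) n) =
      exponentSeries (Finset.univ ×ˢ Finset.Icc 1 n) (fun d => ¬ OrbitDvd a (μ (r - 1)) d) := by
  have hf : Function.Injective fun p : Fin c × ColIdx n => (p.1, (p.2.1 : ℕ)) :=
    Function.injective_id.prodMap Subtype.val_injective
  refine hseries_comap_rename hf (fun p => ?_) fun x => ?_
  · simp only [mem_orbitIdealC_orbMonC, not_not]
  · simp only [Finset.mem_product, Finset.mem_univ, true_and, Set.mem_range]
    constructor
    · intro hx
      exact ⟨(x.1, ⟨x.2, hx⟩), rfl⟩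
    · rintro ⟨y, rfl⟩
      exact y.2.2

theorem Finsupp.le_filter_iff {ι : Type*} {w d : ι →₀ ℕ} {t : Finset ι} [DecidableEq ι]
    (hw : w.support ⊆ t) : w ≤ d.filter (· ∈ t) ↔ w ≤ d := by
  refine forall_congr' fun x => ?_
  by_cases hx : x ∈ t
  · simp [hx]
  · have : w x = 0 := Finsupp.notMem_support_iff.1 fun h => hx (hw h)
    simp [this]

theorem StrictMono.add_sub_le_nat {π : ℕ → ℕ} (hπ : StrictMono π) {i j : ℕ} (hij : i ≤ j) :
    π i + (j - i) ≤ π j := by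
  induction j, hij using Nat.le_induction with
  | base => simp
  | succ k hk ih =>
    have := hπ (Nat.lt_succ_self k)
    simp only [Nat.succ_eq_add_one] at this
    omega

namespace OrbitDvd

variable {c : ℕ} {a : Fin c → ℕ → ℕ} {M M' n : ℕ} {d : Fin c × ℕ →₀ ℕ}

theorem mono {e : Fin c × ℕ →₀ ℕ} (h : OrbitDvd a M d) (hde : d ≤ e) : OrbitDvd a M e := by
  obtain ⟨π, hπ, hle⟩ := h
  exact ⟨π, hπ, fun i j hj => (hle i j hj).trans (hde _)⟩

theorem snd_le_of_ne_zero (hd : d.support ⊆ Finset.univ ×ˢ Finset.Icc 1 n) {x : Fin c × ℕ}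
    (hx : d x ≠ 0) : x.2 ≤ n := by
  have := hd (Finsupp.mem_support_iff.2 hx)
  simp only [Finset.mem_product, Finset.mem_Icc] at this
  exact this.2.2

theorem support_filter_subset (d : Fin c × ℕ →₀ ℕ) (u : Finset (Fin c × ℕ)) :
    (d.filter (· ∈ u)).support ⊆ u := fun x hx => by
  rw [Finsupp.support_filter, Finset.mem_filter] at hx
  exact hx.2

theorem apply_le_filter {j : ℕ} {π : ℕ → ℕ} (hπ : StrictMono π) (hj : 1 ≤ j) (hjn : π j ≤ n)
    (i : Fin c) :
    d (i, π j) ≤ (d.filter (· ∈ (Finset.univ : Finset (Fin c)) ×ˢ Finset.Icc 1 n)) (i, π j) := by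
  have h1 : 1 ≤ π j := hj.trans (hπ.id_le j)
  rw [Finsupp.filter_apply_pos]
  simp [h1, hjn]

theorem filter_pred (hM : 1 ≤ M) (haM : ∃ i, a i M ≠ 0)
    (hd : d.support ⊆ Finset.univ ×ˢ Finset.Icc 1 n) (hW : ¬ ∀ i, a i M ≤ d (i, n))
    (h : OrbitDvd a M d) :
    OrbitDvd a M (d.filter (· ∈ (Finset.univ : Finset (Fin c)) ×ˢ Finset.Icc 1 (n - 1))) := by
  obtain ⟨π, hπ, hle⟩ := h
  have hMmem : M ∈ Finset.Icc 1 M := Finset.mem_Icc.2 ⟨hM, le_rfl⟩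
  obtain ⟨i₀, hi₀⟩ := haM
  have hn : π M ≤ n := snd_le_of_ne_zero hd (x := (i₀, π M)) fun h0 =>
    hi₀ (Nat.le_zero.1 (h0 ▸ hle i₀ M hMmem))
  have hne : π M ≠ n := fun h0 => hW fun i => h0 ▸ hle i M hMmem
  refine ⟨π, hπ, fun i j hj => (hle i j hj).trans (apply_le_filter hπ (Finset.mem_Icc.1 hj).1 ?_ i)⟩
  have := hπ.monotone (Finset.mem_Icc.1 hj).2
  omega

theorem filter_initial (hM : 1 ≤ M') (hlt : M' < M) (haM : ∃ i, a i M ≠ 0)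
    (hd : d.support ⊆ Finset.univ ×ˢ Finset.Icc 1 n) (h : OrbitDvd a M d) :
    OrbitDvd a M'
      (d.filter (· ∈ (Finset.univ : Finset (Fin c)) ×ˢ Finset.Icc 1 (n - (M - M')))) := by
  obtain ⟨π, hπ, hle⟩ := h
  have hMmem : M ∈ Finset.Icc 1 M := Finset.mem_Icc.2 ⟨by omega, le_rfl⟩
  obtain ⟨i₀, hi₀⟩ := haM
  have hn : π M ≤ n := snd_le_of_ne_zero hd (x := (i₀, π M)) fun h0 =>
    hi₀ (Nat.le_zero.1 (h0 ▸ hle i₀ M hMmem))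
  refine ⟨π, hπ, fun i j hj => ?_⟩
  obtain ⟨hj1, hj2⟩ := Finset.mem_Icc.1 hj
  refine (hle i j (Finset.mem_Icc.2 ⟨hj1, by omega⟩)).trans (apply_le_filter hπ hj1 ?_ i)
  have h1 := hπ.monotone hj2
  have h2 := hπ.add_sub_le_nat hlt.le
  omega

theorem extend (hM : 1 ≤ M') (hlt : M' < M) (haM' : ∃ i, a i M' ≠ 0)
    (hgap : ∀ i j, M' < j → j < M → a i j = 0) (hn : M - M' ≤ n)
    (hW : ∀ i, a i M ≤ d (i, n))
    (h : OrbitDvd a M'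
      (d.filter (· ∈ (Finset.univ : Finset (Fin c)) ×ˢ Finset.Icc 1 (n - (M - M'))))) :
    OrbitDvd a M d := by
  obtain ⟨π, hπ, hle⟩ := h
  obtain ⟨i₀, hi₀⟩ := haM'
  have hM'n : π M' ≤ n - (M - M') :=
    snd_le_of_ne_zero (support_filter_subset d _) (x := (i₀, π M')) fun h0 =>
      hi₀ (Nat.le_zero.1 (h0 ▸ hle i₀ M' (Finset.mem_Icc.2 ⟨hM, le_rfl⟩)))
  refine ⟨fun j => if j ≤ M' then π j else n + j - M, fun x y hxy => ?_, fun i j hj => ?_⟩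
  · have h1 := hπ hxy
    simp only
    split_ifs with hx hy hy
    · exact h1
    · have := hπ.monotone hx
      omega
    · omega
    · omega
  · obtain ⟨hj1, hj2⟩ := Finset.mem_Icc.1 hj
    by_cases hjM' : j ≤ M'
    · simp only [hjM', if_true]
      refine (hle i j (Finset.mem_Icc.2 ⟨hj1, hjM'⟩)).trans ?_
      rw [Finsupp.filter_apply]
      split_ifs
      exacts [le_rfl, Nat.zero_le _]
    · simp only [hjM', if_false]
      rcases hj2.lt_or_eq with hj2 | rfl
      · rw [hgap i j (by omega) hj2]
        exact Nat.zero_le _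
      · rw [Nat.add_sub_cancel]
        exact hW i

theorem exponentSeries_recursion (hM : 1 ≤ M') (hlt : M' < M) (haM : ∃ i, a i M ≠ 0)
    (haM' : ∃ i, a i M' ≠ 0) (hgap : ∀ i j, M' < j → j < M → a i j = 0) (hn : M - M' ≤ n) :
    (1 - PowerSeries.X : PowerSeries ℤ) ^ (c * (M - M')) *
        exponentSeries (Finset.univ ×ˢ Finset.Icc 1 n) (fun d => ¬ OrbitDvd a M d) =
      (1 - PowerSeries.X : PowerSeries ℤ) ^ (c * (M - M' - 1)) *
          (1 - (PowerSeries.X : PowerSeries ℤ) ^ (∑ i : Fin c, a i M)) *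
          exponentSeries (Finset.univ ×ˢ Finset.Icc 1 (n - 1)) (fun d => ¬ OrbitDvd a M d) +
        (PowerSeries.X : PowerSeries ℤ) ^ (∑ i : Fin c, a i M) *
          exponentSeries (Finset.univ ×ˢ Finset.Icc 1 (n - (M - M')))
            (fun d => ¬ OrbitDvd a M' d) := by
  classical
  set w : Fin c × ℕ →₀ ℕ := ∑ i : Fin c, Finsupp.single (i, n) (a i M) with hw
  set t : Finset (Fin c × ℕ) := Finset.univ ×ˢ {n} with ht
  set t' : Finset (Fin c × ℕ) := Finset.univ ×ˢ Finset.Icc (n - (M - M') + 1) n with ht'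
  have hwapp : ∀ i j, w (i, j) = if j = n then a i M else 0 := by
    intro i j
    rw [hw, Finsupp.finsetSum_apply, Finset.sum_eq_single i]
    · simp [Finsupp.single_apply, eq_comm]
    · intro i' _ hne
      simp [hne]
    · simp
  have hwle : ∀ d : Fin c × ℕ →₀ ℕ, w ≤ d ↔ ∀ i, a i M ≤ d (i, n) := by
    intro d
    constructor
    · intro h i
      simpa [hwapp] using h (i, n)
    · rintro h ⟨i, j⟩
      rw [hwapp]
      split_ifs with hj
      exacts [hj ▸ h i, Nat.zero_le _]
  have hwt : w.support ⊆ t := by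
    rintro ⟨i, j⟩ hij
    rw [Finsupp.mem_support_iff, hwapp] at hij
    simpa [ht] using (ite_ne_right_iff.1 hij).1.symm
  have htt' : t ⊆ t' := by
    refine Finset.product_subset_product_right ?_
    rw [Finset.singleton_subset_iff, Finset.mem_Icc]
    omega
  have hwt' : w.support ⊆ t' := hwt.trans htt'
  have hunion : (Finset.univ : Finset (Fin c)) ×ˢ Finset.Icc 1 n =
      Finset.univ ×ˢ Finset.Icc 1 (n - 1) ∪ t := by
    ext ⟨i, j⟩
    simp only [ht, Finset.mem_product, Finset.mem_univ, Finset.mem_Icc, Finset.mem_union,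
      Finset.mem_singleton, true_and]
    omega
  have hunion' : (Finset.univ : Finset (Fin c)) ×ˢ Finset.Icc 1 n =
      Finset.univ ×ˢ Finset.Icc 1 (n - (M - M')) ∪ t' := by
    ext ⟨i, j⟩
    simp only [ht', Finset.mem_product, Finset.mem_univ, Finset.mem_Icc, Finset.mem_union,
      true_and]
    omega
  have hdisj : Disjoint ((Finset.univ : Finset (Fin c)) ×ˢ Finset.Icc 1 (n - 1)) t := by
    rw [Finset.disjoint_left]
    rintro ⟨i, j⟩
    simp only [ht, Finset.mem_product, Finset.mem_univ, Finset.mem_Icc, Finset.mem_singleton,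
      true_and]
    omega
  have hdisj' : Disjoint ((Finset.univ : Finset (Fin c)) ×ˢ Finset.Icc 1 (n - (M - M'))) t' := by
    rw [Finset.disjoint_left]
    rintro ⟨i, j⟩
    simp only [ht', Finset.mem_product, Finset.mem_univ, Finset.mem_Icc, true_and]
    omega
  have hfilter : ∀ (d : Fin c × ℕ →₀ ℕ) (u : Finset (Fin c × ℕ)), d.filter (· ∈ u) ≤ d := by
    intro d u x
    rw [Finsupp.filter_apply]
    split_ifs
    exacts [le_rfl, Nat.zero_le _]
  have hdvd : exponentSeries (Finset.univ ×ˢ Finset.Icc 1 n)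
      (fun d => ¬ OrbitDvd a M d ∧ w ≤ d) =
      exponentSeries (Finset.univ ×ˢ Finset.Icc 1 (n - (M - M'))) (fun d => ¬ OrbitDvd a M' d) *
        exponentSeries t' (w ≤ ·) := by
    rw [hunion']
    refine exponentSeries.mul hdisj' fun d hd => ?_
    rw [← hunion'] at hd
    rw [Finsupp.le_filter_iff hwt']
    refine and_congr_left fun hwd => not_congr ⟨filter_initial hM hlt haM hd, ?_⟩
    exact extend hM hlt haM' hgap hn ((hwle d).1 hwd)
  have hndvd : exponentSeries (Finset.univ ×ˢ Finset.Icc 1 n)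
      (fun d => ¬ OrbitDvd a M d ∧ ¬ w ≤ d) =
      exponentSeries (Finset.univ ×ˢ Finset.Icc 1 (n - 1)) (fun d => ¬ OrbitDvd a M d) *
        exponentSeries t (fun d => ¬ w ≤ d) := by
    rw [hunion]
    refine exponentSeries.mul hdisj fun d hd => ?_
    rw [← hunion] at hd
    rw [Finsupp.le_filter_iff hwt]
    refine and_congr_left fun hwd => not_congr ⟨?_, fun h => h.mono (hfilter d _)⟩
    exact filter_pred (hM.trans hlt.le) haM hd (mt (hwle d).2 hwd)
  have hsum : t.sum w = ∑ i : Fin c, a i M := by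
    simp [ht, hwapp]
  have hsum' : t'.sum w = ∑ i : Fin c, a i M := by
    rw [← hsum]
    refine (Finset.sum_subset htt' fun x _ hx => ?_).symm
    exact Finsupp.notMem_support_iff.1 fun h => hx (hwt h)
  have hsplit := exponentSeries.and_add_and_not t (fun _ => True) (w ≤ ·)
  simp only [true_and] at hsplit
  rw [exponentSeries.le_eq_X_pow_mul hwt, hsum] at hsplit
  have hcard := exponentSeries.one_sub_X_pow_card_mul t
  have hcard' := exponentSeries.one_sub_X_pow_card_mul t'
  have htc : t.card = c := by simp [ht]
  have htc' : t'.card = c * (M - M') := by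
    simp only [ht', Finset.card_product, Finset.card_univ, Fintype.card_fin, Nat.card_Icc]
    congr 1
    omega
  rw [htc] at hcard
  rw [htc'] at hcard'
  have hpow : (1 - PowerSeries.X : PowerSeries ℤ) ^ (c * (M - M')) =
      (1 - PowerSeries.X) ^ (c * (M - M' - 1)) * (1 - PowerSeries.X) ^ c := by
    rw [← pow_add, ← Nat.mul_succ]
    congr 2
    omega
  rw [exponentSeries.and_add_and_not _ _ (w ≤ ·), hdvd, hndvd,
    exponentSeries.le_eq_X_pow_mul hwt', hsum', ← sub_eq_of_eq_add' hsplit, mul_add]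
  generalize exponentSeries (Finset.univ ×ˢ Finset.Icc 1 (n - (M - M')))
    (fun d => ¬ OrbitDvd a M' d) = B
  generalize exponentSeries (Finset.univ ×ˢ Finset.Icc 1 (n - 1))
    (fun d => ¬ OrbitDvd a M d) = A
  generalize exponentSeries t (fun _ => True) = T at *
  generalize exponentSeries t' (fun _ => True) = T' at *
  generalize (PowerSeries.X : PowerSeries ℤ) ^ (∑ i : Fin c, a i M) = Y
  have h1 : (1 - PowerSeries.X : PowerSeries ℤ) ^ (c * (M - M')) * (B * (Y * T')) = Y * B := by
    linear_combination B * Y * hcard'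
  have h2 : (1 - PowerSeries.X : PowerSeries ℤ) ^ (c * (M - M')) * (A * (T - Y * T)) =
      (1 - PowerSeries.X) ^ (c * (M - M' - 1)) * (1 - Y) * A := by
    rw [hpow]
    linear_combination ((1 - PowerSeries.X) ^ (c * (M - M' - 1)) * (1 - Y) * A) * hcard
  rw [h1, h2, add_comm]

end OrbitDvd

/-- For `r ≥ 2`, `δ_r = μ_r - μ_{r-1}`, `b_r = Σᵢ a_{i,μ_r}` and `n ≥ δ_r`:
`(1-t)^{cδ_r}·H_{A_n}(t) = (1-t)^{c(δ_r-1)}·(1-t^{b_r})·H_{A_{n-1}}(t) + t^{b_r}·H_{B_{n-δ_r}}(t)`. -/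
theorem statement13 (K : Type*) [Field K] (c : ℕ) (hc : 1 ≤ c) (r : ℕ) (hr : 2 ≤ r)
    (μ : ℕ → ℕ) (hμ1 : 1 ≤ μ 0) (hμ : ∀ j, j + 1 < r → μ j < μ (j + 1))
    (a : Fin c → ℕ → ℕ) (hcols : ∀ j : ℕ, (∃ i, a i j ≠ 0) ↔ ∃ k, k < r ∧ j = μ k)
    (n : ℕ) (hn : μ (r - 1) - μ (r - 2) ≤ n) :
    (1 - PowerSeries.X : PowerSeries ℤ) ^ (c * (μ (r - 1) - μ (r - 2))) *
        hseries K (restrC K (orbitIdealC K (orbMonC K c r μ a)) n) =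
      (1 - PowerSeries.X : PowerSeries ℤ) ^ (c * (μ (r - 1) - μ (r - 2) - 1)) *
          (1 - (PowerSeries.X : PowerSeries ℤ) ^ (∑ i : Fin c, a i (μ (r - 1)))) *
          hseries K (restrC K (orbitIdealC K (orbMonC K c r μ a)) (n - 1)) +
        (PowerSeries.X : PowerSeries ℤ) ^ (∑ i : Fin c, a i (μ (r - 1))) *
          hseries K (restrC K (orbitIdealC K (orbMonC K c (r - 1) μ a))
            (n - (μ (r - 1) - μ (r - 2)))) := by
  have hstep := hμ (r - 2) (by omega)
  rw [show r - 2 + 1 = r - 1 by omega] at hstep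
  have hmono : StrictMonoOn μ (Set.Iio r) := by
    refine strictMonoOn_of_lt_succ Set.ordConnected_Iio fun k _ _ hk => hμ k ?_
    simpa using hk
  have hpos : 1 ≤ μ (r - 2) :=
    hμ1.trans (hmono.monotoneOn (Set.mem_Iio.2 (by omega)) (Set.mem_Iio.2 (by omega))
      (Nat.zero_le _))
  rw [hseries_restrC_orbMonC, hseries_restrC_orbMonC, hseries_restrC_orbMonC,
    show r - 1 - 1 = r - 2 by omega]
  refine OrbitDvd.exponentSeries_recursion hpos hstep ((hcols _).2 ⟨r - 1, by omega, rfl⟩)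
    ((hcols _).2 ⟨r - 2, by omega, rfl⟩) (fun i j hj1 hj2 => ?_) hn
  by_contra hij
  obtain ⟨k, hk, rfl⟩ := (hcols j).1 ⟨i, hij⟩
  have h1 := (hmono.lt_iff_lt (Set.mem_Iio.2 (by omega)) (Set.mem_Iio.2 hk)).1 hj1
  have h2 := (hmono.lt_iff_lt (Set.mem_Iio.2 hk) (Set.mem_Iio.2 (by omega))).1 hj2
  omega
end

section
/- In the polynomial ring ℤ[s,t], the polynomial g̃(s,t) = (1−t)^{c(μ_r−r)} · ∏_{j=1}^{r} ((1−t)^c − s + s·t^{b_j}) − s^{μ_r} · t^{b_1 + ⋯ + b_r} is divisible by ((1−t)^c − s), but for each j ∈ {1, …, r} it is not divisible by the polynomial (1−t)^{c−1} − s·(1 + t + ⋯ + t^{b_j−1}). -/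
theorem sub_dvd_pow_mul_prod_sub {R ι : Type*} [CommRing R] (a s t : R) (I : Finset ι)
    (b : ι → ℕ) {m : ℕ} (hm : I.card ≤ m) :
    (a - s) ∣ a ^ (m - I.card) * ∏ j ∈ I, (a - s + s * t ^ b j) - s ^ m * t ^ ∑ j ∈ I, b j := by
  rw [← Ideal.mem_span_singleton, ← Ideal.Quotient.eq_zero_iff_mem]
  set q := Ideal.Quotient.mk (Ideal.span {a - s})
  have h : q a = q s := Ideal.Quotient.eq.2 (Ideal.mem_span_singleton_self _)
  simp only [map_sub, map_mul, map_prod, map_add, map_pow, h, sub_self, zero_add,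
    Finset.prod_mul_distrib, Finset.prod_const, Finset.prod_pow_eq_pow_sum]
  rw [← mul_assoc, ← pow_add, Nat.sub_add_cancel hm, sub_self]

theorem succ_le_of_lt_succ_of_lt {μ : ℕ → ℕ} {r : ℕ} (h0 : 1 ≤ μ 0)
    (hμ : ∀ j, j + 1 < r → μ j < μ (j + 1)) : ∀ j, j < r → j + 1 ≤ μ j
  | 0, _ => h0
  | j + 1, hj =>
    (Nat.succ_le_succ (succ_le_of_lt_succ_of_lt h0 hμ j (by omega))).trans (hμ j hj)

theorem not_sub_mul_geom_sum_dvd {c r m e : ℕ} (hc : 1 ≤ c) (b : ℕ → ℕ) (n j : ℕ) (hj : j < r)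
    (hb : 0 < b j) :
    letI s : Polynomial (Polynomial ℤ) := Polynomial.X
    letI t : Polynomial (Polynomial ℤ) := Polynomial.C Polynomial.X
    ¬ (((1 - t) ^ (c - 1) - s * ∑ k ∈ Finset.range (b j), t ^ k) ∣
      (1 - t) ^ n * ∏ j ∈ Finset.range r, ((1 - t) ^ c - s + s * t ^ b j) - s ^ m * t ^ e) := by
  intro hdvd
  set G : ℚ := ∑ k ∈ Finset.range (b j), 2 ^ k with hG
  have hG0 : G ≠ 0 :=
    (Finset.sum_pos (fun _ _ => by positivity) (Finset.nonempty_range_iff.2 hb.ne')).ne'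
  have hgeom : G = 2 ^ b j - 1 := by
    rw [hG, geom_sum_eq (by norm_num)]
    norm_num
  set x : ℚ := (1 - 2) ^ (c - 1) / G with hx
  have hx0 : x ≠ 0 := div_ne_zero (pow_ne_zero _ (by norm_num)) hG0
  have hxG : x * G = (1 - 2) ^ (c - 1) := div_mul_cancel₀ _ hG0
  have hφ := map_dvd
    (Polynomial.eval₂RingHom (Polynomial.eval₂RingHom (Int.castRingHom ℚ) 2) x) hdvd
  simp only [map_sub, map_mul, map_prod, map_sum, map_add, map_pow, map_one,
    Polynomial.coe_eval₂RingHom, Polynomial.eval₂_X, Polynomial.eval₂_C] at hφ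
  rw [← hG, hxG, sub_self, zero_dvd_iff, Finset.prod_eq_zero (Finset.mem_range.2 hj), mul_zero,
    zero_sub, neg_eq_zero] at hφ
  · exact mul_ne_zero (pow_ne_zero _ hx0) (pow_ne_zero _ two_ne_zero) hφ
  · obtain ⟨d, rfl⟩ := Nat.exists_eq_add_of_le' hc
    rw [Nat.add_sub_cancel] at hxG
    rw [pow_succ, ← hxG, hgeom]
    ring

/-- In `ℤ[s,t]` (realized as `(ℤ[t])[s]`, with `s` the outer and `t` the
inner variable), the polynomial
`g̃(s,t) = (1-t)^{c(μ_r-r)}·∏ⱼ((1-t)^c - s + s·t^{b_j}) - s^{μ_r}·t^{b₁+⋯+b_r}`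
is divisible by `(1-t)^c - s` but, for each `j < r`, not by
`(1-t)^{c-1} - s·(1+t+⋯+t^{b_j-1})`. -/
theorem statement15 (c : ℕ) (hc : 1 ≤ c) (r : ℕ) (hr : 1 ≤ r) (b μ : ℕ → ℕ)
    (hb : ∀ j, j < r → 0 < b j)
    (hμ1 : 1 ≤ μ 0) (hμ : ∀ j, j + 1 < r → μ j < μ (j + 1)) :
    letI s : Polynomial (Polynomial ℤ) := Polynomial.X
    letI t : Polynomial (Polynomial ℤ) := Polynomial.C Polynomial.X
    letI g : Polynomial (Polynomial ℤ) :=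
      (1 - t) ^ (c * (μ (r - 1) - r)) *
          ∏ j ∈ Finset.range r, ((1 - t) ^ c - s + s * t ^ b j) -
        s ^ μ (r - 1) * t ^ (∑ j ∈ Finset.range r, b j)
    ((1 - t) ^ c - s) ∣ g ∧
      ∀ j, j < r → ¬ (((1 - t) ^ (c - 1) - s * ∑ k ∈ Finset.range (b j), t ^ k) ∣ g) := by
  refine ⟨?_, fun j hj => ?_⟩
  swap
  · exact not_sub_mul_geom_sum_dvd hc b _ j hj (hb j hj)
  have hm : (Finset.range r).card ≤ μ (r - 1) := by
    have := succ_le_of_lt_succ_of_lt hμ1 hμ (r - 1) (by omega)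
    rw [Finset.card_range]
    omega
  have h := sub_dvd_pow_mul_prod_sub ((1 - Polynomial.C Polynomial.X) ^ c)
    (Polynomial.X : Polynomial (Polynomial ℤ)) (Polynomial.C Polynomial.X) (Finset.range r) b hm
  rwa [Finset.card_range, ← pow_mul] at h
end

section
/- Set b_j = Σ_{i=1}^{c} a_{i,μ_j} for j = 1, …, r. For every n ≥ μ_r − 1, the power series f_n(t) := (1−t)^{n(c−1)+μ_r−1} · H_{A_n}(t) is a polynomial in ℤ[t], and its value at t = 1 equals the coefficient of t^{n−μ_r+1} in the power series ∏_{j=1}^{r} 1/(1 − b_j t); that is, f_n(1) = Σ b_1^{k_1} b_2^{k_2} ⋯ b_r^{k_r}, where the sum runs over all tuples (k_1, …, k_r) of non-negative integers with k_1 + ⋯ + k_r = n − μ_r + 1. -/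
open MvPolynomial

/-- The generating series `∑ t ^ wt x` of a type whose weight function has finite fibres. -/
noncomputable def weightSeries {α : Type*} (wt : α → ℕ) : PowerSeries ℤ :=
  PowerSeries.mk fun j => (Nat.card {x // wt x = j} : ℤ)

theorem weightSeries_congr {α β : Type*} {wt : α → ℕ} {wt' : β → ℕ} (e : α ≃ β)
    (h : ∀ x, wt' (e x) = wt x) : weightSeries wt = weightSeries wt' := by
  ext j
  simp only [weightSeries, PowerSeries.coeff_mk]
  rw [Nat.card_congr (e.subtypeEquiv (p := fun x => wt x = j) (q := fun x => wt' x = j)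
    fun x => by rw [h])]

theorem weightSeries_sum {α β : Type*} {wt : α → ℕ} {wt' : β → ℕ}
    (hα : ∀ j, Finite {x // wt x = j}) (hβ : ∀ j, Finite {x // wt' x = j}) :
    weightSeries (Sum.elim wt wt') = weightSeries wt + weightSeries wt' := by
  ext j
  have h1 : Finite {x // Sum.elim wt wt' (Sum.inl x) = j} := hα j
  have h2 : Finite {x // Sum.elim wt wt' (Sum.inr x) = j} := hβ j
  simp only [weightSeries, PowerSeries.coeff_mk, map_add]
  rw [Nat.card_congr (Equiv.subtypeSum (p := fun x => Sum.elim wt wt' x = j)), Nat.card_sum]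
  simp

/-- The fibres of an additive weight on a product, sorted by the weights of the factors. -/
def prodFiberEquiv {α β : Type*} (wt : α → ℕ) (wt' : β → ℕ) (j : ℕ) :
    {p : α × β // wt p.1 + wt' p.2 = j} ≃
      Σ q : {q // q ∈ Finset.HasAntidiagonal.antidiagonal j},
        {x // wt x = q.1.1} × {y // wt' y = q.1.2} where
  toFun p := ⟨⟨(wt p.1.1, wt' p.1.2), by simpa using p.2⟩, ⟨p.1.1, rfl⟩, ⟨p.1.2, rfl⟩⟩
  invFun s := ⟨(s.2.1.1, s.2.2.1), by
    rw [s.2.1.2, s.2.2.2]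
    exact Finset.HasAntidiagonal.mem_antidiagonal.1 s.1.2⟩
  left_inv _ := rfl
  right_inv := by
    rintro ⟨⟨⟨i, k⟩, h⟩, ⟨x, hx⟩, ⟨y, hy⟩⟩
    dsimp only at hx hy
    subst hx hy
    rfl

theorem finite_weight_prod {α β : Type*} {wt : α → ℕ} {wt' : β → ℕ}
    (hα : ∀ j, Finite {x // wt x = j}) (hβ : ∀ j, Finite {x // wt' x = j}) (j : ℕ) :
    Finite {p : α × β // wt p.1 + wt' p.2 = j} :=
  Finite.of_equiv _ (prodFiberEquiv wt wt' j).symm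

theorem weightSeries_prod {α β : Type*} {wt : α → ℕ} {wt' : β → ℕ}
    (hα : ∀ j, Finite {x // wt x = j}) (hβ : ∀ j, Finite {x // wt' x = j}) :
    weightSeries (fun p : α × β => wt p.1 + wt' p.2) = weightSeries wt * weightSeries wt' := by
  ext j
  simp only [weightSeries, PowerSeries.coeff_mk, PowerSeries.coeff_mul]
  rw [Nat.card_congr (prodFiberEquiv wt wt' j), Nat.card_sigma, Nat.cast_sum]
  simp only [Nat.card_prod, Nat.cast_mul]
  exact Finset.sum_coe_sort (Finset.HasAntidiagonal.antidiagonal j)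
    (fun q => (Nat.card {x // wt x = q.1} : ℤ) * Nat.card {y // wt' y = q.2})

theorem finite_weight_pi {ι : Type*} [Fintype ι] (j : ℕ) :
    Finite {w : ι → ℕ // ∑ i, w i = j} := by
  classical
  refine ((Set.finite_Icc (0 : ι → ℕ) (fun _ => j)).subset ?_).to_subtype
  intro w hw
  refine ⟨fun i => Nat.zero_le _, fun i => ?_⟩
  rw [← show ∑ i, w i = j from hw]
  exact Finset.single_le_sum (f := w) (fun _ _ => Nat.zero_le _) (Finset.mem_univ i)

theorem finite_weight_subtype {α : Type*} {wt : α → ℕ} (h : ∀ j, Finite {x // wt x = j})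
    (P : α → Prop) (j : ℕ) : Finite {x : {x // P x} // wt x.1 = j} := by
  have := h j
  exact Finite.of_injective (fun x => (⟨x.1.1, x.2⟩ : {x // wt x = j}))
    fun x y hxy => Subtype.ext (Subtype.ext (congrArg (fun z => z.1) hxy))

theorem one_sub_X_pow_mul_weightSeries_pi (c : ℕ) :
    (1 - PowerSeries.X : PowerSeries ℤ) ^ c *
      weightSeries (fun w : Fin c → ℕ => ∑ i, w i) = 1 := by
  induction c with
  | zero =>
    ext j
    rcases eq_or_ne j 0 with rfl | h
    · simp [weightSeries]
    · simp [weightSeries, PowerSeries.coeff_one, h, h.symm]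
  | succ c ih =>
    have h1 : weightSeries (fun x : ℕ => x) = PowerSeries.mk 1 := by
      ext j; simp [weightSeries]
    have h2 := weightSeries_prod (wt := fun x : ℕ => x) (wt' := fun w : Fin c → ℕ => ∑ i, w i)
      (fun j => inferInstance) finite_weight_pi
    rw [← weightSeries_congr (wt := fun p : ℕ × (Fin c → ℕ) => p.1 + ∑ i, p.2 i)
      (Fin.consEquiv fun _ => ℕ) (fun p => by simp [Fin.consEquiv, Fin.sum_univ_succ]),
      h2, h1, pow_succ]
    calc _ = ((1 - PowerSeries.X) ^ c * weightSeries (fun w : Fin c → ℕ => ∑ i, w i)) *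
          (PowerSeries.mk 1 * (1 - PowerSeries.X)) := by ring
      _ = 1 := by rw [ih, PowerSeries.mk_one_mul_one_sub_eq_one, one_mul]

theorem weightSeries_const_add {α : Type*} (wt : α → ℕ) (d : ℕ) :
    weightSeries (fun x => d + wt x) = PowerSeries.X ^ d * weightSeries wt := by
  ext j
  simp only [weightSeries, PowerSeries.coeff_mk, PowerSeries.coeff_X_pow_mul']
  split_ifs with h
  · congr 1
    refine Nat.card_congr (Equiv.subtypeEquivRight fun x => ?_)
    omega
  · have : IsEmpty {x // d + wt x = j} := ⟨fun x => h (x.2 ▸ Nat.le_add_right _ _)⟩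
    simp

theorem weightSeries_le {c : ℕ} (a : Fin c → ℕ) :
    weightSeries (fun w : {w : Fin c → ℕ // a ≤ w} => ∑ i, w.1 i) =
      PowerSeries.X ^ (∑ i, a i) * weightSeries (fun w : Fin c → ℕ => ∑ i, w i) := by
  let e : (Fin c → ℕ) ≃ {w : Fin c → ℕ // a ≤ w} :=
    { toFun := fun w => ⟨a + w, le_self_add⟩
      invFun := fun w => w.1 - a
      left_inv := fun w => add_tsub_cancel_left a w
      right_inv := fun w => Subtype.ext (add_tsub_cancel_of_le w.2) }
  rw [← weightSeries_const_add]
  exact (weightSeries_congr e fun w => by simp [e, Finset.sum_add_distrib]).symm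

theorem weightSeries_not_le {c : ℕ} (a : Fin c → ℕ) :
    weightSeries (fun w : {w : Fin c → ℕ // ¬ a ≤ w} => ∑ i, w.1 i) =
      (1 - PowerSeries.X ^ (∑ i, a i)) * weightSeries (fun w : Fin c → ℕ => ∑ i, w i) := by
  classical
  have h := weightSeries_congr (wt := Sum.elim
      (fun w : {w : Fin c → ℕ // a ≤ w} => ∑ i, w.1 i)
      (fun w : {w : Fin c → ℕ // ¬ a ≤ w} => ∑ i, w.1 i)) (wt' := fun w => ∑ i, w i)
    (Equiv.sumCompl fun w : Fin c → ℕ => a ≤ w) (by rintro (x | x) <;> simp)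
  rw [weightSeries_sum (finite_weight_subtype finite_weight_pi _)
    (finite_weight_subtype finite_weight_pi _), weightSeries_le] at h
  linear_combination h

/-- The word `w` of length `n` dominates, letter by letter along a strictly increasing choice
of positions, the first `m` letters of `a`. -/
def IncDominates {α : Type*} [LE α] (a : ℕ → α) (m : ℕ) {n : ℕ} (w : Fin n → α) : Prop :=
  ∃ π : ℕ → ℕ, StrictMono π ∧ ∀ j < m, ∃ h : π j < n, a j ≤ w ⟨π j, h⟩

theorem incDominates_zero {α : Type*} [LE α] (a : ℕ → α) {n : ℕ} (w : Fin n → α) :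
    IncDominates a 0 w :=
  ⟨id, strictMono_id, fun _ h => absurd h (Nat.not_lt_zero _)⟩

theorem not_incDominates_of_lt {α : Type*} [LE α] (a : ℕ → α) {m n : ℕ} (h : n < m)
    (w : Fin n → α) : ¬ IncDominates a m w := by
  rintro ⟨π, hπ, H⟩
  obtain ⟨h', -⟩ := H n h
  exact absurd (hπ.id_le n) (by simpa using h')

theorem incDominates_cons_of_le {α : Type*} [LE α] {a : ℕ → α} {m n : ℕ} {x : α}
    {w : Fin n → α} (hx : a 0 ≤ x) :
    IncDominates a (m + 1) (Fin.cons x w : Fin (n + 1) → α) ↔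
      IncDominates (fun j => a (j + 1)) m w := by
  constructor
  · rintro ⟨π, hπ, H⟩
    have hpos (j : ℕ) : π (j + 1) - 1 + 1 = π (j + 1) :=
      Nat.succ_pred_eq_of_pos ((Nat.zero_le _).trans_lt (hπ (Nat.succ_pos j)))
    refine ⟨fun j => π (j + 1) - 1, strictMono_nat_of_lt_succ fun j => ?_, fun j hj => ?_⟩
    · have := hπ (Nat.lt_succ_self (j + 1))
      have := hpos j
      have := hpos (j + 1)
      simp only [Nat.succ_eq_add_one] at *
      omega
    · obtain ⟨h, hle⟩ := H (j + 1) (by omega)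
      have hp := hpos j
      refine ⟨by dsimp only; omega, ?_⟩
      have hf : (⟨π (j + 1), h⟩ : Fin (n + 1)) = Fin.succ ⟨π (j + 1) - 1, by omega⟩ :=
        Fin.ext hp.symm
      rw [hf, Fin.cons_succ] at hle
      exact hle
  · rintro ⟨π, hπ, H⟩
    refine ⟨fun j => Nat.casesOn j 0 fun j => π j + 1, strictMono_nat_of_lt_succ fun j => ?_,
      fun j hj => ?_⟩
    · cases j with
      | zero => exact Nat.succ_pos _
      | succ j => exact Nat.succ_lt_succ (hπ (Nat.lt_succ_self j))
    · cases j with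
      | zero => exact ⟨Nat.succ_pos _, hx⟩
      | succ j =>
        obtain ⟨h, hle⟩ := H j (by omega)
        exact ⟨Nat.succ_lt_succ h, hle⟩

theorem incDominates_cons_of_not_le {α : Type*} [LE α] {a : ℕ → α} {m n : ℕ} {x : α}
    {w : Fin n → α} (hx : ¬ a 0 ≤ x) :
    IncDominates a (m + 1) (Fin.cons x w : Fin (n + 1) → α) ↔ IncDominates a (m + 1) w := by
  constructor
  · rintro ⟨π, hπ, H⟩
    have h0 : π 0 ≠ 0 := by
      intro h0
      obtain ⟨h, hle⟩ := H 0 (Nat.succ_pos m)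
      have hf : (⟨π 0, h⟩ : Fin (n + 1)) = 0 := Fin.ext h0
      rw [hf] at hle
      exact hx hle
    have hpos (j : ℕ) : π j - 1 + 1 = π j :=
      Nat.succ_pred_eq_of_pos ((Nat.pos_of_ne_zero h0).trans_le (hπ.monotone (Nat.zero_le j)))
    refine ⟨fun j => π j - 1, strictMono_nat_of_lt_succ fun j => ?_, fun j hj => ?_⟩
    · have := hπ (Nat.lt_succ_self j)
      have := hpos j
      have := hpos (j + 1)
      simp only [Nat.succ_eq_add_one] at *
      omega
    · obtain ⟨h, hle⟩ := H j hj
      have hp := hpos j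
      refine ⟨by dsimp only; omega, ?_⟩
      have hf : (⟨π j, h⟩ : Fin (n + 1)) = Fin.succ ⟨π j - 1, by omega⟩ := Fin.ext hp.symm
      rw [hf, Fin.cons_succ] at hle
      exact hle
  · rintro ⟨π, hπ, H⟩
    refine ⟨fun j => π j + 1, fun i j hij => Nat.succ_lt_succ (hπ hij), fun j hj => ?_⟩
    obtain ⟨h, hle⟩ := H j hj
    exact ⟨Nat.succ_lt_succ h, hle⟩

/-- The generating series, by total weight, of the words of length `n` over `ℕ ^ c` that do not
dominate the first `m` letters of `a`. -/
noncomputable def avoidSeries {c : ℕ} (a : ℕ → Fin c → ℕ) (m n : ℕ) : PowerSeries ℤ :=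
  weightSeries fun w : {w : Fin n → Fin c → ℕ // ¬ IncDominates a m w} => ∑ j, ∑ i, w.1 j i

theorem finite_weight_word {c n : ℕ} (j : ℕ) :
    Finite {w : Fin n → Fin c → ℕ // ∑ k, ∑ i, w k i = j} := by
  have := finite_weight_pi (ι := Fin n × Fin c) j
  refine Finite.of_injective (fun w => (⟨fun p => w.1 p.1 p.2, ?_⟩ :
    {w : Fin n × Fin c → ℕ // ∑ i, w i = j})) fun w w' h => ?_
  · rw [Fintype.sum_prod_type]
    exact w.2
  · ext k i
    exact congrFun (congrArg Subtype.val h) (k, i)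

theorem avoidSeries_zero_left {c : ℕ} (a : ℕ → Fin c → ℕ) (n : ℕ) : avoidSeries a 0 n = 0 := by
  have : IsEmpty {w : Fin n → Fin c → ℕ // ¬ IncDominates a 0 w} :=
    ⟨fun w => w.2 (incDominates_zero a w.1)⟩
  ext j
  simp [avoidSeries, weightSeries]

theorem avoidSeries_zero_right {c : ℕ} (a : ℕ → Fin c → ℕ) (m : ℕ) :
    avoidSeries a (m + 1) 0 = 1 := by
  have : Unique {w : Fin 0 → Fin c → ℕ // ¬ IncDominates a (m + 1) w} :=
    { default := ⟨Fin.elim0, not_incDominates_of_lt a (Nat.succ_pos m) _⟩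
      uniq := fun w => Subtype.ext (Subsingleton.elim _ _) }
  ext j
  rcases eq_or_ne j 0 with rfl | h
  · simp [avoidSeries, weightSeries]
  · simp [avoidSeries, weightSeries, PowerSeries.coeff_one, h, h.symm]

theorem avoidSeries_succ {c : ℕ} (a : ℕ → Fin c → ℕ) (m n : ℕ) :
    avoidSeries a (m + 1) (n + 1) =
      weightSeries (fun w : Fin c → ℕ => ∑ i, w i) *
        (PowerSeries.X ^ (∑ i, a 0 i) * avoidSeries (fun j => a (j + 1)) m n +
          (1 - PowerSeries.X ^ (∑ i, a 0 i)) * avoidSeries a (m + 1) n) := by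
  let f : {x : Fin c → ℕ // a 0 ≤ x} ×
        {w : Fin n → Fin c → ℕ // ¬ IncDominates (fun j => a (j + 1)) m w} ⊕
      {x : Fin c → ℕ // ¬ a 0 ≤ x} × {w : Fin n → Fin c → ℕ // ¬ IncDominates a (m + 1) w} →
      {w : Fin (n + 1) → Fin c → ℕ // ¬ IncDominates a (m + 1) w} :=
    Sum.elim
      (fun p => ⟨Fin.cons p.1.1 p.2.1, mt (incDominates_cons_of_le p.1.2).1 p.2.2⟩)
      (fun p => ⟨Fin.cons p.1.1 p.2.1, mt (incDominates_cons_of_not_le p.1.2).1 p.2.2⟩)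
  have hf : Function.Bijective f := by
    constructor
    · rintro (⟨⟨x, hx⟩, w, hw⟩ | ⟨⟨x, hx⟩, w, hw⟩) (⟨⟨y, hy⟩, v, hv⟩ | ⟨⟨y, hy⟩, v, hv⟩) h <;>
        obtain ⟨rfl, rfl⟩ := Fin.cons_inj.1 (show (Fin.cons x w : Fin (n + 1) → Fin c → ℕ) =
          Fin.cons y v from congrArg Subtype.val h)
      · rfl
      · exact absurd hx hy
      · exact absurd hy hx
      · rfl
    · rintro ⟨w, hw⟩
      obtain ⟨x, w, rfl⟩ : ∃ x v, w = Fin.cons x v := ⟨w 0, Fin.tail w, (Fin.cons_self_tail w).symm⟩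
      by_cases hx : a 0 ≤ x
      · exact ⟨Sum.inl (⟨x, hx⟩, ⟨w, mt (incDominates_cons_of_le hx).2 hw⟩), rfl⟩
      · exact ⟨Sum.inr (⟨x, hx⟩, ⟨w, mt (incDominates_cons_of_not_le hx).2 hw⟩), rfl⟩
  have fin1 (P : (Fin c → ℕ) → Prop) := finite_weight_subtype (finite_weight_pi (ι := Fin c)) P
  have fin2 (P : (Fin n → Fin c → ℕ) → Prop) :=
    finite_weight_subtype (finite_weight_word (c := c) (n := n)) P
  have h := weightSeries_congr (wt := Sum.elim
      (fun p : {x : Fin c → ℕ // a 0 ≤ x} ×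
        {w : Fin n → Fin c → ℕ // ¬ IncDominates (fun j => a (j + 1)) m w} =>
          ∑ i, p.1.1 i + ∑ j, ∑ i, p.2.1 j i)
      (fun p : {x : Fin c → ℕ // ¬ a 0 ≤ x} ×
        {w : Fin n → Fin c → ℕ // ¬ IncDominates a (m + 1) w} =>
          ∑ i, p.1.1 i + ∑ j, ∑ i, p.2.1 j i))
    (wt' := fun w : {w : Fin (n + 1) → Fin c → ℕ // ¬ IncDominates a (m + 1) w} =>
      ∑ j, ∑ i, w.1 j i)
    (Equiv.ofBijective f hf) (by rintro (p | p) <;> simp [f, Fin.sum_univ_succ])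
  rw [weightSeries_sum (finite_weight_prod (fin1 _) (fin2 _)) (finite_weight_prod (fin1 _) (fin2 _)),
    weightSeries_prod (fin1 _) (fin2 _), weightSeries_prod (fin1 _) (fin2 _),
    weightSeries_le, weightSeries_not_le] at h
  rw [avoidSeries, ← h]
  simp only [avoidSeries]
  ring

/-- The geometric series `1 / (1 - β t)`. -/
noncomputable def geomSeries (β : ℕ) : PowerSeries ℤ := PowerSeries.mk fun i => (β : ℤ) ^ i

theorem geomSeries_zero : geomSeries 0 = 1 := by
  ext j
  simp [geomSeries, PowerSeries.coeff_one, zero_pow_eq]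

theorem geomSeries_eq (β : ℕ) :
    geomSeries β = 1 + PowerSeries.C (β : ℤ) * (PowerSeries.X * geomSeries β) := by
  ext j
  cases j with
  | zero => simp [geomSeries]
  | succ j =>
    rw [map_add, PowerSeries.coeff_C_mul, PowerSeries.coeff_succ_X_mul]
    simp [geomSeries, PowerSeries.coeff_one, pow_succ']

theorem coeff_succ_prod_geomSeries (b : ℕ → ℕ) (m k : ℕ) :
    PowerSeries.coeff (k + 1) (∏ j ∈ Finset.range (m + 1), geomSeries (b j)) =
      PowerSeries.coeff (k + 1) (∏ j ∈ Finset.range m, geomSeries (b (j + 1))) +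
        b 0 * PowerSeries.coeff k (∏ j ∈ Finset.range (m + 1), geomSeries (b j)) := by
  rw [Finset.prod_range_succ']
  set P := ∏ j ∈ Finset.range m, geomSeries (b (j + 1))
  have h : P * geomSeries (b 0) =
      P + PowerSeries.C (b 0 : ℤ) * (PowerSeries.X * (P * geomSeries (b 0))) := by
    linear_combination P * geomSeries_eq (b 0)
  conv_lhs => rw [h]
  rw [map_add, PowerSeries.coeff_C_mul, PowerSeries.coeff_succ_X_mul]

theorem coeff_zero_prod_geomSeries (b : ℕ → ℕ) (m : ℕ) :
    PowerSeries.coeff 0 (∏ j ∈ Finset.range m, geomSeries (b j)) = 1 := by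
  rw [PowerSeries.coeff_zero_eq_constantCoeff, map_prod]
  exact Finset.prod_eq_one fun j _ => by simp [geomSeries]

theorem coeff_prod_geomSeries (b : ℕ → ℕ) (r k : ℕ) :
    PowerSeries.coeff k (∏ j ∈ Finset.range r, geomSeries (b j)) =
      ((∑ l ∈ Finset.Nat.antidiagonalTuple r k, ∏ i : Fin r, b i ^ l i : ℕ) : ℤ) := by
  rw [Finset.prod_range, PowerSeries.coeff_prod, Nat.cast_sum]
  refine Finset.sum_bij' (fun l _ => ⇑l) (fun l _ => Finsupp.equivFunOnFinite.symm l) ?_ ?_ ?_ ?_ ?_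
  · intro l hl
    simpa [Finset.Nat.mem_antidiagonalTuple] using hl
  · intro l hl
    simpa [Finset.Nat.mem_antidiagonalTuple] using hl
  · intro l hl
    ext; simp
  · intro l hl
    ext; simp
  · intro l hl
    simp [geomSeries]

theorem one_sub_X_pow_mul_avoidSeries_succ {c : ℕ} (a : ℕ → Fin c → ℕ) (m n : ℕ) :
    (1 - PowerSeries.X : PowerSeries ℤ) ^ (c * (n + 1)) * avoidSeries a (m + 1) (n + 1) =
      PowerSeries.X ^ (∑ i, a 0 i) *
          ((1 - PowerSeries.X) ^ (c * n) * avoidSeries (fun j => a (j + 1)) m n) +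
        (1 - PowerSeries.X ^ (∑ i, a 0 i)) *
          ((1 - PowerSeries.X) ^ (c * n) * avoidSeries a (m + 1) n) := by
  rw [avoidSeries_succ, mul_add, mul_one, pow_add]
  linear_combination (1 - PowerSeries.X : PowerSeries ℤ) ^ (c * n) *
    (PowerSeries.X ^ (∑ i, a 0 i) * avoidSeries (fun j => a (j + 1)) m n +
          (1 - PowerSeries.X ^ (∑ i, a 0 i)) * avoidSeries a (m + 1) n) *
    one_sub_X_pow_mul_weightSeries_pi c

theorem one_sub_X_pow_mul_avoidSeries_of_lt {c : ℕ} (a : ℕ → Fin c → ℕ) {m n : ℕ} (h : n < m) :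
    (1 - PowerSeries.X : PowerSeries ℤ) ^ (c * n) * avoidSeries a m n = 1 := by
  induction n generalizing a m with
  | zero =>
    obtain ⟨m, rfl⟩ := Nat.exists_eq_succ_of_ne_zero h.ne'
    simp [avoidSeries_zero_right]
  | succ n ih =>
    obtain ⟨m, rfl⟩ := Nat.exists_eq_succ_of_ne_zero (Nat.ne_zero_of_lt h)
    rw [one_sub_X_pow_mul_avoidSeries_succ, ih _ (by omega), ih _ (by omega)]
    ring

theorem exists_polynomial_avoidSeries {c : ℕ} (a : ℕ → Fin c → ℕ) (m n k : ℕ)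
    (h : n + 1 = m + k) :
    ∃ p : Polynomial ℤ,
      (1 - PowerSeries.X : PowerSeries ℤ) ^ (c * n) * avoidSeries a m n =
        (1 - PowerSeries.X) ^ k * (p : PowerSeries ℤ) ∧
      p.eval 1 =
        PowerSeries.coeff k (∏ j ∈ Finset.range m, geomSeries (∑ i, a j i)) := by
  induction n generalizing a m k with
  | zero =>
    obtain ⟨rfl, rfl⟩ | ⟨rfl, rfl⟩ : m = 0 ∧ k = 1 ∨ m = 1 ∧ k = 0 := by omega
    · exact ⟨0, by simp [avoidSeries_zero_left], by simp [PowerSeries.coeff_one]⟩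
    · refine ⟨1, ?_, ?_⟩
      · simp [avoidSeries_zero_right]
      · rw [coeff_zero_prod_geomSeries, Polynomial.eval_one]
  | succ n ih =>
    cases k with
    | zero =>
      refine ⟨1, ?_, ?_⟩
      · rw [one_sub_X_pow_mul_avoidSeries_of_lt a (by omega)]
        simp
      · rw [coeff_zero_prod_geomSeries, Polynomial.eval_one]
    | succ k =>
      cases m with
      | zero =>
        exact ⟨0, by simp [avoidSeries_zero_left], by simp [PowerSeries.coeff_one]⟩
      | succ m =>
        obtain ⟨p, hp, hp'⟩ := ih (fun j => a (j + 1)) m (k + 1) (by omega)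
        obtain ⟨q, hq, hq'⟩ := ih a (m + 1) k (by omega)
        refine ⟨Polynomial.X ^ (∑ i, a 0 i) * p +
          (∑ i ∈ Finset.range (∑ i, a 0 i), Polynomial.X ^ i) * q, ?_, ?_⟩
        · rw [one_sub_X_pow_mul_avoidSeries_succ, hp, hq]
          have hg := congrArg (fun p : Polynomial ℤ => (p : PowerSeries ℤ))
            (mul_neg_geom_sum (Polynomial.X : Polynomial ℤ) (∑ i, a 0 i))
          simp only [Polynomial.coe_mul, Polynomial.coe_sub, Polynomial.coe_one,
            Polynomial.coe_X, Polynomial.coe_pow] at hg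
          simp only [Polynomial.coe_mul, Polynomial.coe_add, Polynomial.coe_X, Polynomial.coe_pow]
          rw [← hg]
          ring
        · rw [coeff_succ_prod_geomSeries (fun j => ∑ i, a j i)]
          simp only [Polynomial.eval_add, Polynomial.eval_mul, Polynomial.eval_pow,
            Polynomial.eval_X, Polynomial.eval_finsetSum, one_pow, hp', hq']
          simp

theorem finite_finsupp_degree {σ : Type*} [Finite σ] (j : ℕ) :
    Finite {u : σ →₀ ℕ // u.degree = j} := by
  have := Fintype.ofFinite σ
  have := finite_weight_pi (ι := σ) j
  refine Finite.of_injective (fun u => (⟨⇑u.1, by rw [← Finsupp.degree_eq_sum, u.2]⟩ :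
    {w : σ → ℕ // ∑ i, w i = j})) fun u v h => ?_
  exact Subtype.ext (DFunLike.coe_injective (congrArg Subtype.val h))

/-- If membership in `I` is decided by the support lying in `T`, the monomials outside `T` form
bases of the graded pieces of the quotient. -/
theorem hilbF_eq_card (K : Type*) [Field K] {σ : Type*} [Finite σ] (I : Ideal (MvPolynomial σ K))
    (T : Set (σ →₀ ℕ)) (hT : ∀ p : MvPolynomial σ K, p ∈ I ↔ ∀ u ∈ p.support, u ∈ T) (j : ℕ) :
    hilbF K I j = Nat.card {u : {u : σ →₀ ℕ // u ∉ T} // u.1.degree = j} := by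
  classical
  have : Finite {u : {u : σ →₀ ℕ // u ∉ T} // u.1.degree = j} :=
    finite_weight_subtype (wt := Finsupp.degree) finite_finsupp_degree _ j
  have := Fintype.ofFinite {u : {u : σ →₀ ℕ // u ∉ T} // u.1.degree = j}
  let ψ : homogeneousSubmodule σ K j →ₗ[K]
      ({u : {u : σ →₀ ℕ // u ∉ T} // u.1.degree = j} → K) :=
    (LinearMap.pi fun u => MvPolynomial.lcoeff K u.1.1) ∘ₗ (homogeneousSubmodule σ K j).subtype
  have hψ (p : homogeneousSubmodule σ K j) (u) : ψ p u = coeff u.1.1 p.1 := rfl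
  have hker : LinearMap.ker ψ = Submodule.comap (homogeneousSubmodule σ K j).subtype
      (Submodule.restrictScalars K I) := by
    ext p
    rw [LinearMap.mem_ker, Submodule.mem_comap, Submodule.restrictScalars_mem]
    change _ ↔ p.1 ∈ I
    rw [hT]
    constructor
    · intro h u hu
      by_contra hu'
      refine MvPolynomial.mem_support_iff.1 hu ?_
      have hd : u.degree = j := by
        have := (mem_homogeneousSubmodule j p.1).1 p.2 (MvPolynomial.mem_support_iff.1 hu)
        rwa [Finsupp.degree_eq_weight_one]
      exact congrFun h ⟨⟨u, hu'⟩, hd⟩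
    · intro h
      ext u
      rw [hψ]
      by_contra hne
      exact u.1.2 (h _ (MvPolynomial.mem_support_iff.2 hne))
  have hsurj : Function.Surjective ψ := by
    intro g
    refine ⟨⟨∑ u, monomial u.1.1 (g u), Submodule.sum_mem _ fun u _ =>
      isHomogeneous_monomial _ u.2⟩, ?_⟩
    ext v
    rw [hψ]
    simp only [coeff_sum, coeff_monomial]
    rw [Finset.sum_eq_single v]
    · simp
    · intro u _ huv
      rw [if_neg fun h => huv (Subtype.ext (Subtype.ext h))]
    · simp
  rw [hilbF, ← hker, (LinearMap.quotKerEquivOfSurjective ψ hsurj).finrank_eq,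
    Module.finrank_fintype_fun_eq_card, Nat.card_eq_fintype_card]

theorem mem_restrC_orbitIdealC_iff (K : Type*) [Field K] (c r : ℕ) (μ : ℕ → ℕ)
    (a : Fin c → ℕ → ℕ) (n : ℕ) (p : MvPolynomial (Fin c × ColIdx n) K) :
    p ∈ restrC K (orbitIdealC K (orbMonC K c r μ a)) n ↔
      ∀ u ∈ p.support, ∃ π : ℕ → ℕ, StrictMono π ∧ ∀ i, ∀ j ∈ Finset.Icc 1 (μ (r - 1)),
        a i j ≤ Finsupp.mapDomain (fun q : Fin c × ColIdx n => (q.1, q.2.1)) u (i, π j) := by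
  classical
  let e : Fin c × ℕ →₀ ℕ :=
    ∑ i : Fin c, ∑ j ∈ Finset.Icc 1 (μ (r - 1)), Finsupp.single (i, j) (a i j)
  have he (i : Fin c) (j : ℕ) : e (i, j) = if j ∈ Finset.Icc 1 (μ (r - 1)) then a i j else 0 := by
    simp only [e, Finsupp.coe_finsetSum, Finset.sum_apply, Finsupp.single_apply, Prod.mk.injEq]
    rw [Finset.sum_eq_single i (fun i' _ h => by simp [h]) (by simp)]
    simp
  have hmon : orbMonC K c r μ a = monomial e 1 := by
    simp only [orbMonC, e, monomial_sum_one, X_pow_eq_monomial]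
  have hinj (π : ℕ → ℕ) (hπ : StrictMono π) :
      Function.Injective (fun q : Fin c × ℕ => (q.1, π q.2)) :=
    Function.injective_id.prodMap hπ.injective
  have hideal : orbitIdealC K (orbMonC K c r μ a) =
      Ideal.span ((fun s => monomial s (1 : K)) '' {s | ∃ π : ℕ → ℕ, StrictMono π ∧
        s = Finsupp.mapDomain (fun q : Fin c × ℕ => (q.1, π q.2)) e}) := by
    rw [orbitIdealC, hmon]
    congr 1
    ext q
    simp only [rename_monomial, Set.mem_ofPred_eq, Set.mem_image]
    constructor
    · rintro ⟨π, hπ, rfl⟩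
      exact ⟨_, ⟨π, hπ, rfl⟩, rfl⟩
    · rintro ⟨_, ⟨π, hπ, rfl⟩, rfl⟩
      exact ⟨π, hπ, rfl⟩
  have hcol : Function.Injective (fun q : Fin c × ColIdx n => (q.1, q.2.1)) :=
    Function.injective_id.prodMap Subtype.val_injective
  rw [restrC, Ideal.mem_comap, hideal, mem_ideal_span_monomial_image, toBigC,
    support_rename_of_injective hcol, Finset.forall_mem_image]
  refine forall₂_congr fun u _ => ⟨?_, ?_⟩
  · rintro ⟨_, ⟨π, hπ, rfl⟩, hle⟩
    refine ⟨π, hπ, fun i j hj => ?_⟩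
    have := hle (i, π j)
    rw [show (i, π j) = (fun q : Fin c × ℕ => (q.1, π q.2)) (i, j) from rfl,
      Finsupp.mapDomain_apply (hinj π hπ), he, if_pos hj] at this
    exact this
  · rintro ⟨π, hπ, hle⟩
    refine ⟨_, ⟨π, hπ, rfl⟩, fun x => ?_⟩
    by_cases hx : x ∈ Set.range (fun q : Fin c × ℕ => (q.1, π q.2))
    · obtain ⟨⟨i, j⟩, rfl⟩ := hx
      rw [Finsupp.mapDomain_apply (hinj π hπ), he]
      split_ifs with hj
      · exact hle i j hj
      · exact Nat.zero_le _
    · rw [Finsupp.mapDomain_of_notMem_range _ _ hx]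
      exact Nat.zero_le _

/-- The columns `1, …, n` renumbered from `0`. -/
def finColEquiv (n : ℕ) : Fin n ≃ ColIdx n where
  toFun k := ⟨k + 1, by simp⟩
  invFun j := ⟨j.1 - 1, by have := Finset.mem_Icc.1 j.2; omega⟩
  left_inv k := by simp
  right_inv j := by
    have := Finset.mem_Icc.1 j.2
    ext
    simp
    omega

/-- Exponent vectors as words whose letters are the columns. -/
noncomputable def wordEquiv (c n : ℕ) :
    (Fin c × ColIdx n →₀ ℕ) ≃ (Fin n → Fin c → ℕ) where
  toFun u k i := u (i, finColEquiv n k)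
  invFun w := Finsupp.equivFunOnFinite.symm fun q => w ((finColEquiv n).symm q.2) q.1
  left_inv u := by ext; simp
  right_inv w := by ext; simp

theorem sum_wordEquiv (c n : ℕ) (u : Fin c × ColIdx n →₀ ℕ) :
    ∑ k, ∑ i, wordEquiv c n u k i = u.degree := by
  rw [Finsupp.degree_eq_sum, Fintype.sum_prod_type_right, ← (finColEquiv n).sum_comp]
  rfl

theorem incDominates_wordEquiv_iff {c n m : ℕ} (a : Fin c → ℕ → ℕ) (hm : ∃ i, a i m ≠ 0)
    (u : Fin c × ColIdx n →₀ ℕ) :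
    IncDominates (fun j i => a i (j + 1)) m (wordEquiv c n u) ↔
      ∃ π : ℕ → ℕ, StrictMono π ∧ ∀ i, ∀ j ∈ Finset.Icc 1 m,
        a i j ≤ Finsupp.mapDomain (fun q : Fin c × ColIdx n => (q.1, q.2.1)) u (i, π j) := by
  have hcol : Function.Injective (fun q : Fin c × ColIdx n => (q.1, q.2.1)) :=
    Function.injective_id.prodMap Subtype.val_injective
  have hval (i : Fin c) (k : Fin n) : wordEquiv c n u k i =
      Finsupp.mapDomain (fun q : Fin c × ColIdx n => (q.1, q.2.1)) u (i, k.1 + 1) :=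
    (Finsupp.mapDomain_apply hcol u (i, finColEquiv n k)).symm
  constructor
  · rintro ⟨π, hπ, H⟩
    refine ⟨fun j => Nat.casesOn j 0 fun j => π j + 1, strictMono_nat_of_lt_succ fun j => ?_,
      fun i j hj => ?_⟩
    · cases j with
      | zero => exact Nat.succ_pos _
      | succ j => exact Nat.succ_lt_succ (hπ (Nat.lt_succ_self j))
    · obtain ⟨h1, h2⟩ := Finset.mem_Icc.1 hj
      obtain ⟨j, rfl⟩ := Nat.exists_eq_succ_of_ne_zero (Nat.ne_zero_of_lt h1)
      obtain ⟨h, hle⟩ := H j h2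
      exact (hle i).trans (hval i ⟨π j, h⟩).le
  · rintro ⟨π, hπ, H⟩
    have hpos (j : ℕ) : π (j + 1) - 1 + 1 = π (j + 1) :=
      Nat.succ_pred_eq_of_pos ((Nat.zero_le _).trans_lt (hπ (Nat.succ_pos j)))
    refine ⟨fun j => π (j + 1) - 1, strictMono_nat_of_lt_succ fun j => ?_, fun j hj => ?_⟩
    · have := hπ (Nat.lt_succ_self (j + 1))
      have := hpos j
      have := hpos (j + 1)
      simp only [Nat.succ_eq_add_one] at *
      omega
    · obtain ⟨i, hi⟩ := hm
      have hmn : π m ≤ n := by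
        by_contra hlt
        have := H i m (Finset.mem_Icc.2 ⟨by omega, le_rfl⟩)
        rw [Finsupp.mapDomain_of_notMem_range] at this
        · omega
        · rintro ⟨q, hq⟩
          have h1 := (Finset.mem_Icc.1 q.2.2).2
          have h2 : q.2.1 = π m := congrArg Prod.snd hq
          omega
      have h1 : π (j + 1) ≤ π m := hπ.monotone hj
      have h2 := hpos j
      refine ⟨by dsimp only; omega, fun i => ?_⟩
      rw [hval, h2]
      exact H i (j + 1) (Finset.mem_Icc.2 ⟨by omega, hj⟩)

theorem hseries_eq_avoidSeries (K : Type*) [Field K] (c r : ℕ) (μ : ℕ → ℕ)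
    (a : Fin c → ℕ → ℕ) (hm : ∃ i, a i (μ (r - 1)) ≠ 0) (n : ℕ) :
    hseries K (restrC K (orbitIdealC K (orbMonC K c r μ a)) n) =
      avoidSeries (fun j i => a i (j + 1)) (μ (r - 1)) n := by
  let T : Set (Fin c × ColIdx n →₀ ℕ) :=
    {u | IncDominates (fun j i => a i (j + 1)) (μ (r - 1)) (wordEquiv c n u)}
  have hT (p : MvPolynomial (Fin c × ColIdx n) K) :
      p ∈ restrC K (orbitIdealC K (orbMonC K c r μ a)) n ↔ ∀ u ∈ p.support, u ∈ T := by
    rw [mem_restrC_orbitIdealC_iff]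
    exact forall₂_congr fun u _ => (incDominates_wordEquiv_iff a hm u).symm
  rw [avoidSeries, ← weightSeries_congr (wt := fun u : {u // u ∉ T} => u.1.degree)
    ((wordEquiv c n).subtypeEquiv
      (q := fun w => ¬ IncDominates (fun j i => a i (j + 1)) (μ (r - 1)) w) fun _ => Iff.rfl)
    (fun u => sum_wordEquiv c n u.1)]
  ext j
  simp only [hseries, weightSeries, PowerSeries.coeff_mk]
  rw [hilbF_eq_card K _ T hT]

/-- With `b_j = Σᵢ a_{i,μ_j}`, for `n ≥ μ_r - 1` the series
`f_n(t) = (1-t)^{n(c-1)+μ_r-1}·H_{A_n}(t)` is a polynomial in `ℤ[t]` and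
`f_n(1) = Σ_{k₁+⋯+k_r = n-μ_r+1} b₁^{k₁}⋯b_r^{k_r}`, the coefficient of `t^{n-μ_r+1}`
in `∏ⱼ 1/(1-b_jt)`. -/
theorem statement16 (K : Type*) [Field K] (c : ℕ) (hc : 1 ≤ c) (r : ℕ) (hr : 1 ≤ r)
    (μ : ℕ → ℕ) (hμ1 : 1 ≤ μ 0) (hμ : ∀ j, j + 1 < r → μ j < μ (j + 1))
    (a : Fin c → ℕ → ℕ) (hcols : ∀ j : ℕ, (∃ i, a i j ≠ 0) ↔ ∃ k, k < r ∧ j = μ k)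
    (b : ℕ → ℕ) (hb : ∀ j, b j = ∑ i : Fin c, a i (μ j))
    (n : ℕ) (hn : μ (r - 1) ≤ n + 1) :
    ∃ p : Polynomial ℤ,
      (↑p : PowerSeries ℤ) =
        (1 - PowerSeries.X : PowerSeries ℤ) ^ (n * (c - 1) + μ (r - 1) - 1) *
          hseries K (restrC K (orbitIdealC K (orbMonC K c r μ a)) n) ∧
      p.eval 1 =
        ((∑ k ∈ Finset.Nat.antidiagonalTuple r (n + 1 - μ (r - 1)),
          ∏ i : Fin r, b i ^ k i : ℕ) : ℤ) := by
  have hpos : ∀ k, k < r → 1 ≤ μ k := by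
    intro k
    induction k with
    | zero => exact fun _ => hμ1
    | succ k ih =>
      intro hk
      exact (ih (by omega)).trans (hμ k hk).le
  have hlt : ∀ k l, k < l → l < r → μ k < μ l := by
    intro k l hkl
    induction l, hkl using Nat.le_induction with
    | base => exact fun h => hμ k h
    | succ l _ ih => exact fun h => (ih (by omega)).trans (hμ l h)
  have hle : ∀ k, k < r → μ k ≤ μ (r - 1) := by
    intro k hk
    rcases eq_or_ne k (r - 1) with rfl | h
    · exact le_rfl
    · exact (hlt k (r - 1) (by omega) (by omega)).le
  obtain ⟨p, hp, hp1⟩ := exists_polynomial_avoidSeries (fun j i => a i (j + 1)) (μ (r - 1)) n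
    (n + 1 - μ (r - 1)) (by omega)
  refine ⟨p, ?_, ?_⟩
  · have hne : (1 - PowerSeries.X : PowerSeries ℤ) ^ (n + 1 - μ (r - 1)) ≠ 0 := by
      refine pow_ne_zero _ fun h => ?_
      simpa using congrArg (PowerSeries.coeff 0) h
    refine mul_left_cancel₀ hne ?_
    rw [hseries_eq_avoidSeries K c r μ a ((hcols _).2 ⟨r - 1, by omega, rfl⟩), ← hp,
      ← mul_assoc, ← pow_add]
    congr 2
    obtain ⟨c, rfl⟩ := Nat.exists_eq_succ_of_ne_zero (Nat.ne_zero_of_lt hc)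
    have := hpos (r - 1) (by omega)
    rw [Nat.succ_sub_one, Nat.succ_mul, mul_comm n c]
    omega
  · rw [hp1, ← coeff_prod_geomSeries]
    congr 1
    have hinj : Set.InjOn (fun k => μ k - 1) (Finset.range r : Set ℕ) := by
      intro k hk l hl h
      simp only [Finset.coe_range, Set.mem_Iio] at hk hl
      have h1 := hpos k hk
      have h2 := hpos l hl
      dsimp only at h
      rcases lt_trichotomy k l with hkl | hkl | hkl
      · have := hlt k l hkl hl
        omega
      · exact hkl
      · have := hlt l k hkl hk
        omega
    calc ∏ j ∈ Finset.range (μ (r - 1)), geomSeries (∑ i, a i (j + 1))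
        = ∏ j ∈ (Finset.range r).image (fun k => μ k - 1), geomSeries (∑ i, a i (j + 1)) := by
          symm
          refine Finset.prod_subset ?_ ?_
          · intro j hj
            obtain ⟨k, hk, rfl⟩ := Finset.mem_image.1 hj
            have h1 := hpos k (Finset.mem_range.1 hk)
            have h2 := hle k (Finset.mem_range.1 hk)
            rw [Finset.mem_range]
            omega
          · intro j _ hj
            rw [Finset.sum_eq_zero, geomSeries_zero]
            intro i _
            by_contra hne
            obtain ⟨k, hk, hjk⟩ := (hcols (j + 1)).1 ⟨i, hne⟩
            exact hj (Finset.mem_image.2 ⟨k, Finset.mem_range.2 hk, by omega⟩)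
      _ = ∏ k ∈ Finset.range r, geomSeries (b k) := by
          rw [Finset.prod_image hinj]
          refine Finset.prod_congr rfl fun k hk => ?_
          rw [hb, Nat.sub_add_cancel (hpos k (Finset.mem_range.1 hk))]
end
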